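/- arXiv:1710.10408 — 8 statements merged into one kernel-verified Lean document; each statement's English description precedes it below -/
import Mathlib

section
/- Let A be an involutive implication zroupoid (i.e., an I-zroupoid satisfying x'' = x). Then A satisfies the identity (x → y) → ((z → y) → (u → z)) = (x → y) → (u → z) for all x, y, z, u in A. -/
/-- Involutive implication zroupoids, with implication written `x ⇒ y`. -/
class InvolutiveIZroupoid (A : Type*) extends Zero A where
  imp : A → A → A
  imp_imp (x y w : A) : imp (imp x y) w = imp (imp (imp (imp w 0) x) (imp (imp y w) 0)) 0
  neg_neg (x : A) : imp (imp x 0) 0 = x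

namespace InvolutiveIZroupoid

local infixr:60 "⇒" => InvolutiveIZroupoid.imp
local notation:max "∼" x:max => x ⇒ 0

variable {A : Type*} [InvolutiveIZroupoid A]

theorem neg_imp_imp_neg_imp (x y w : A) : (∼x ⇒ y) ⇒ ∼(w ⇒ x) = ∼((y ⇒ w) ⇒ x) := by
  rw [← neg_neg ((∼x ⇒ y) ⇒ ∼(w ⇒ x)), ← imp_imp y w x]

theorem neg_zero_imp (x : A) : ∼0 ⇒ x = x := by
  calc ∼0 ⇒ x
    _ = ∼((∼0 ⇒ x) ⇒ ∼∼0) := by rw [neg_neg 0, neg_neg (∼0 ⇒ x)]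
    _ = x := by rw [neg_imp_imp_neg_imp 0 x 0, neg_neg ∼x, neg_neg x]

theorem neg_imp_neg_zero_imp (x y : A) : ∼((x ⇒ ∼0) ⇒ y) = (∼y ⇒ x) ⇒ ∼y := by
  rw [← neg_imp_imp_neg_imp y x ∼0, neg_zero_imp y]

theorem neg_imp_neg_zero_imp_neg (x y : A) : ∼((x ⇒ ∼0) ⇒ ∼y) = (y ⇒ x) ⇒ y := by
  calc ∼((x ⇒ ∼0) ⇒ ∼y)
    _ = (∼∼y ⇒ x) ⇒ ∼∼y := by rw [neg_imp_neg_zero_imp x ∼y]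
    _ = (∼∼y ⇒ x) ⇒ y := by rw [neg_neg y]
    _ = (y ⇒ x) ⇒ y := by rw [neg_neg y]

theorem neg_zero_imp_imp (x y : A) : ∼((0 ⇒ x) ⇒ y) = y ⇒ ∼(x ⇒ y) := by
  rw [← neg_imp_imp_neg_imp y 0 x, neg_neg y]

theorem zero_imp_neg_zero : (0 : A) ⇒ ∼0 = ∼0 := by
  have h := congrArg (fun t : A => ∼t) (neg_imp_neg_zero_imp_neg ∼0 0)
  simp only [neg_zero_imp, neg_neg] at h
  exact h.symm

theorem neg_imp_self (x : A) : ∼x ⇒ x = x := by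
  rw [← neg_imp_neg_zero_imp_neg 0 x, zero_imp_neg_zero, neg_zero_imp ∼x, neg_neg x]

theorem neg_imp_imp_self_left (x y : A) : ∼((x ⇒ y) ⇒ x) = x ⇒ ∼(y ⇒ x) := by
  rw [← neg_imp_imp_neg_imp x x y, neg_imp_self x]

theorem neg_imp_neg_imp (x y : A) : ∼(x ⇒ ∼(y ⇒ x)) = (x ⇒ y) ⇒ x := by
  rw [← neg_imp_imp_self_left x y, neg_neg ((x ⇒ y) ⇒ x)]

theorem imp_imp_self_eq_zero_imp_imp (x y : A) : (x ⇒ y) ⇒ x = (0 ⇒ y) ⇒ x := by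
  rw [← neg_imp_neg_imp x y, ← neg_zero_imp_imp y x, neg_neg ((0 ⇒ y) ⇒ x)]

theorem imp_neg_self (x : A) : x ⇒ ∼x = ∼x := by
  calc x ⇒ ∼x
    _ = ∼∼x ⇒ ∼x := by rw [neg_neg x]
    _ = ∼x := by rw [neg_imp_self ∼x]

theorem imp_imp_neg_imp_neg (x y w : A) : (x ⇒ y) ⇒ ∼(w ⇒ ∼x) = ∼((y ⇒ w) ⇒ ∼x) := by
  calc (x ⇒ y) ⇒ ∼(w ⇒ ∼x)
    _ = (∼∼x ⇒ y) ⇒ ∼(w ⇒ ∼x) := by rw [neg_neg x]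
    _ = ∼((y ⇒ w) ⇒ ∼x) := by rw [neg_imp_imp_neg_imp ∼x y w]

theorem imp_neg_imp_neg_zero_imp_neg (x y : A) : x ⇒ ∼(y ⇒ ∼(0 ⇒ ∼x)) = ∼y ⇒ ∼x := by
  calc x ⇒ ∼(y ⇒ ∼(0 ⇒ ∼x))
    _ = ((x ⇒ ∼x) ⇒ x) ⇒ ∼(y ⇒ ∼(0 ⇒ ∼x)) := by rw [imp_neg_self x, neg_imp_self x]
    _ = ∼y ⇒ ∼x := by
      rw [imp_imp_self_eq_zero_imp_imp x ∼x, imp_imp_neg_imp_neg (0 ⇒ ∼x) x y,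
        imp_imp_neg_imp_neg x y 0, neg_neg (∼y ⇒ ∼x)]

theorem zero_imp_neg (x : A) : 0 ⇒ ∼x = x ⇒ ∼0 := by
  calc 0 ⇒ ∼x
    _ = 0 ⇒ ∼(∼x ⇒ ∼(0 ⇒ ∼0)) := by rw [imp_neg_self 0, neg_neg 0, neg_neg ∼x]
    _ = x ⇒ ∼0 := by rw [imp_neg_imp_neg_zero_imp_neg 0 ∼x, neg_neg x]

theorem neg_imp_neg_imp_neg_zero_imp (x y : A) : ∼x ⇒ ∼(y ⇒ ∼(0 ⇒ x)) = ∼y ⇒ x := by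
  rw [← neg_imp_neg_imp 0 x, imp_neg_imp_neg_zero_imp_neg ∼x y, neg_neg x]

theorem zero_imp_neg_zero_imp (x : A) : 0 ⇒ ∼(0 ⇒ x) = 0 ⇒ ∼x := by
  rw [zero_imp_neg (0 ⇒ x), ← imp_imp_self_eq_zero_imp_imp ∼0 x, ← zero_imp_neg (∼0 ⇒ x),
    neg_zero_imp x]

theorem zero_imp_zero_imp (x : A) : 0 ⇒ (0 ⇒ x) = 0 ⇒ x := by
  calc 0 ⇒ (0 ⇒ x)
    _ = 0 ⇒ ∼(0 ⇒ ∼(0 ⇒ x)) := by rw [zero_imp_neg_zero_imp ∼(0 ⇒ x), neg_neg (0 ⇒ x)]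
    _ = 0 ⇒ x := by rw [zero_imp_neg_zero_imp x, zero_imp_neg_zero_imp ∼x, neg_neg x]

theorem neg_imp_zero_imp_neg (x y : A) : ∼x ⇒ (0 ⇒ ∼y) = 0 ⇒ ∼(x ⇒ y) := by
  rw [← neg_neg (∼x ⇒ (0 ⇒ ∼y)), ← neg_imp_imp_neg_imp (0 ⇒ ∼y) x 0, zero_imp_zero_imp ∼y,
    imp_imp_self_eq_zero_imp_imp ∼(0 ⇒ ∼y) x, zero_imp_neg y, imp_imp_neg_imp_neg 0 x y,
    ← zero_imp_neg (x ⇒ y), neg_neg (0 ⇒ ∼(x ⇒ y))]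

theorem zero_imp_neg_neg_imp (x y : A) : 0 ⇒ ∼(∼x ⇒ y) = x ⇒ (0 ⇒ ∼y) := by
  rw [← neg_imp_zero_imp_neg ∼x y, neg_neg x]

theorem imp_zero_imp (x y : A) : x ⇒ (0 ⇒ y) = 0 ⇒ (x ⇒ y) := by
  calc x ⇒ (0 ⇒ y)
    _ = 0 ⇒ ∼(∼x ⇒ (0 ⇒ ∼y)) := by
      rw [zero_imp_neg_neg_imp x (0 ⇒ ∼y), zero_imp_neg_zero_imp ∼y, neg_neg y]
    _ = 0 ⇒ (x ⇒ y) := by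
      rw [neg_imp_zero_imp_neg x y, zero_imp_neg_zero_imp ∼(x ⇒ y), neg_neg (x ⇒ y)]

theorem zero_imp_imp_imp_self (x y : A) : (0 ⇒ (x ⇒ y)) ⇒ x = (0 ⇒ y) ⇒ x := by
  rw [← imp_zero_imp x y, imp_imp_self_eq_zero_imp_imp x (0 ⇒ y), zero_imp_zero_imp y]

theorem neg_imp_neg_zero_imp_eq (x y : A) : ∼((x ⇒ ∼0) ⇒ y) = (0 ⇒ x) ⇒ ∼y := by
  rw [neg_imp_neg_zero_imp x y, imp_imp_self_eq_zero_imp_imp ∼y x]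

theorem neg_imp_imp_neg_left_eq (x y : A) : ∼(x ⇒ y) ⇒ ∼x = x ⇒ (∼y ⇒ ∼x) := by
  calc ∼(x ⇒ y) ⇒ ∼x
    _ = x ⇒ ∼((∼∼x ⇒ y) ⇒ ∼(0 ⇒ ∼x)) := by rw [imp_neg_imp_neg_zero_imp_neg x (∼∼x ⇒ y), neg_neg x]
    _ = x ⇒ (∼y ⇒ ∼x) := by rw [neg_imp_imp_neg_imp ∼x y 0, neg_neg (∼y ⇒ ∼x)]

theorem zero_imp_neg_imp_neg (x y : A) : (0 ⇒ ∼x) ⇒ ∼y = ∼((0 ⇒ x) ⇒ y) := by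
  rw [← zero_imp_neg_zero_imp x, ← neg_imp_neg_zero_imp_eq ∼(0 ⇒ x) y,
    neg_imp_imp_neg_left_eq 0 x, ← zero_imp_neg ∼x, neg_neg x, zero_imp_zero_imp x]

theorem zero_imp_neg_imp_neg_eq_zero_imp_neg (x y : A) : 0 ⇒ (∼x ⇒ ∼y) = 0 ⇒ ∼(x ⇒ y) := by
  rw [← imp_zero_imp ∼x ∼y, neg_imp_zero_imp_neg x y]

theorem zero_imp_neg_imp_neg_right (x y : A) : 0 ⇒ ∼(x ⇒ ∼y) = 0 ⇒ (∼x ⇒ y) := by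
  rw [← zero_imp_neg_imp_neg_eq_zero_imp_neg x ∼y, neg_neg y]

theorem zero_imp_imp_imp_imp (x y w : A) : (0 ⇒ (x ⇒ y)) ⇒ (w ⇒ x) = ((y ⇒ ∼0) ⇒ w) ⇒ x := by
  calc (0 ⇒ (x ⇒ y)) ⇒ (w ⇒ x)
    _ = (0 ⇒ ∼(∼x ⇒ ∼y)) ⇒ ∼∼(w ⇒ x) := by
      rw [zero_imp_neg_imp_neg_right ∼x y, neg_neg x, neg_neg (w ⇒ x)]
    _ = ∼((0 ⇒ (∼x ⇒ ∼y)) ⇒ ∼(w ⇒ x)) := by rw [zero_imp_neg_imp_neg (∼x ⇒ ∼y) ∼(w ⇒ x)]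
    _ = ∼((∼x ⇒ (0 ⇒ ∼y)) ⇒ ∼(w ⇒ x)) := by rw [imp_zero_imp ∼x ∼y]
    _ = ((y ⇒ ∼0) ⇒ w) ⇒ x := by
      rw [zero_imp_neg y, neg_imp_imp_neg_imp x (y ⇒ ∼0) w, neg_neg (((y ⇒ ∼0) ⇒ w) ⇒ x)]

theorem zero_imp_neg_imp_imp (x y : A) : (0 ⇒ ∼x) ⇒ (y ⇒ x) = y ⇒ x := by
  rw [← neg_neg (y ⇒ x), ← neg_imp_neg_zero_imp_eq ∼x ∼(y ⇒ x), neg_imp_imp_neg_imp x ∼0 y,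
    neg_zero_imp y, neg_neg (y ⇒ x)]

theorem zero_imp_imp_imp_self_imp (x y : A) : (0 ⇒ x) ⇒ (x ⇒ y) = x ⇒ (x ⇒ y) := by
  calc (0 ⇒ x) ⇒ (x ⇒ y)
    _ = ((x ⇒ y) ⇒ x) ⇒ (x ⇒ y) := by rw [imp_imp_self_eq_zero_imp_imp (x ⇒ y) x]
    _ = ((0 ⇒ y) ⇒ x) ⇒ (x ⇒ y) := by rw [imp_imp_self_eq_zero_imp_imp x y]
    _ = ((0 ⇒ ∼∼(x ⇒ y)) ⇒ x) ⇒ (x ⇒ y) := by rw [neg_neg (x ⇒ y), zero_imp_imp_imp_self x y]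
    _ = ((∼(x ⇒ y) ⇒ ∼0) ⇒ x) ⇒ (x ⇒ y) := by rw [zero_imp_neg ∼(x ⇒ y)]
    _ = (0 ⇒ ((x ⇒ y) ⇒ ∼(x ⇒ y))) ⇒ (x ⇒ (x ⇒ y)) := by
      rw [zero_imp_imp_imp_imp (x ⇒ y) ∼(x ⇒ y) x]
    _ = x ⇒ (x ⇒ y) := by rw [imp_neg_self (x ⇒ y), zero_imp_neg_imp_imp (x ⇒ y) x]

theorem neg_imp_imp_self_right (x y : A) : ∼x ⇒ (y ⇒ x) = y ⇒ x := by
  rw [← neg_neg y, ← neg_imp_neg_imp_neg_zero_imp x ∼y,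
    ← zero_imp_imp_imp_self_imp ∼x ∼(∼y ⇒ ∼(0 ⇒ x)), neg_imp_neg_imp_neg_zero_imp x ∼y,
    zero_imp_neg_imp_imp x ∼∼y, neg_neg y]

theorem imp_imp_neg_zero_imp_eq (x y : A) : (x ⇒ y) ⇒ ∼(0 ⇒ y) = ∼(∼(x ⇒ y) ⇒ y) := by
  calc (x ⇒ y) ⇒ ∼(0 ⇒ y)
    _ = (x ⇒ y) ⇒ ∼(0 ⇒ ∼∼y) := by rw [neg_neg y]
    _ = (x ⇒ y) ⇒ ∼(∼y ⇒ ∼0) := by rw [zero_imp_neg ∼y]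
    _ = (∼y ⇒ (x ⇒ y)) ⇒ ∼(0 ⇒ ∼∼y) := by rw [zero_imp_neg ∼y, neg_imp_imp_self_right y x]
    _ = ∼(∼(x ⇒ y) ⇒ y) := by rw [imp_imp_neg_imp_neg ∼y (x ⇒ y) 0, neg_neg y]

theorem imp_imp_neg_self (x y : A) : x ⇒ (y ⇒ ∼x) = y ⇒ ∼x := by
  calc x ⇒ (y ⇒ ∼x)
    _ = ∼∼x ⇒ (y ⇒ ∼x) := by rw [neg_neg x]
    _ = y ⇒ ∼x := by rw [neg_imp_imp_self_right ∼x y]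

theorem neg_imp_imp_neg_left (x y : A) : ∼(x ⇒ y) ⇒ ∼x = ∼y ⇒ ∼x := by
  rw [neg_imp_imp_neg_left_eq x y, imp_imp_neg_self x ∼y]

theorem zero_imp_imp_neg_imp_self (x y : A) : 0 ⇒ (x ⇒ ∼(y ⇒ x)) = 0 ⇒ ∼(y ⇒ x) := by
  rw [← neg_imp_imp_self_left x y, ← zero_imp_neg_imp_neg_eq_zero_imp_neg (x ⇒ y) x,
    neg_imp_imp_neg_left x y, zero_imp_neg_imp_neg_eq_zero_imp_neg y x]

theorem zero_imp_zero_imp_imp (x y : A) : 0 ⇒ ((0 ⇒ x) ⇒ y) = x ⇒ (0 ⇒ y) := by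
  rw [← neg_neg ((0 ⇒ x) ⇒ y), ← zero_imp_neg_imp_neg x y, neg_zero_imp_imp ∼x ∼y,
    ← neg_imp_imp_neg_left y x, zero_imp_imp_neg_imp_self ∼y ∼(y ⇒ x), neg_imp_imp_neg_left y x,
    zero_imp_neg_neg_imp x ∼y, neg_neg y]

theorem imp_neg_zero_imp_imp (x y : A) : x ⇒ ∼(0 ⇒ (y ⇒ x)) = ∼((0 ⇒ y) ⇒ x) := by
  calc x ⇒ ∼(0 ⇒ (y ⇒ x))
    _ = x ⇒ ∼((0 ⇒ (x ⇒ y)) ⇒ (0 ⇒ x)) := by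
      rw [imp_zero_imp (0 ⇒ (x ⇒ y)) x, zero_imp_imp_imp_self x y, zero_imp_zero_imp_imp y x,
        imp_zero_imp y x]
    _ = x ⇒ ∼(∼(y ⇒ ∼0) ⇒ x) := by rw [zero_imp_imp_imp_imp x y 0]
    _ = ∼((0 ⇒ ∼(y ⇒ ∼0)) ⇒ x) := by rw [neg_zero_imp_imp ∼(y ⇒ ∼0) x]
    _ = ∼((0 ⇒ y) ⇒ x) := by rw [zero_imp_neg_imp_neg_right y 0, neg_neg y]

theorem neg_imp_neg_zero_imp_neg_eq (x y : A) : ∼x ⇒ ∼(0 ⇒ ∼y) = ∼(x ⇒ ∼(0 ⇒ y)) := by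
  rw [← imp_neg_imp_neg_zero_imp_neg (0 ⇒ ∼y) x, imp_neg_zero_imp_imp 0 y, neg_neg (0 ⇒ y),
    zero_imp_neg_imp_neg y (x ⇒ ∼(0 ⇒ y)), imp_imp_neg_self (0 ⇒ y) x]

theorem imp_imp_neg_right (x y : A) : (x ⇒ y) ⇒ ∼y = y ⇒ ∼(x ⇒ y) := by
  calc (x ⇒ y) ⇒ ∼y
    _ = (∼y ⇒ (x ⇒ y)) ⇒ ∼y := by rw [neg_imp_imp_self_right y x]
    _ = ∼(∼y ⇒ ∼((x ⇒ y) ⇒ ∼y)) := by rw [neg_imp_neg_imp ∼y (x ⇒ y)]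
    _ = ∼(∼y ⇒ ((∼∼y ⇒ x) ⇒ ∼(y ⇒ ∼y))) := by rw [neg_imp_imp_neg_imp ∼y x y]
    _ = ∼(∼y ⇒ ((∼∼y ⇒ x) ⇒ ∼∼y)) := by rw [imp_neg_self y]
    _ = ∼(∼y ⇒ ((y ⇒ x) ⇒ ∼∼y)) := by rw [neg_neg y]
    _ = ∼(∼y ⇒ ((y ⇒ x) ⇒ y)) := by rw [neg_neg y]
    _ = ∼((y ⇒ x) ⇒ y) := by rw [neg_imp_imp_self_right y (y ⇒ x)]
    _ = y ⇒ ∼(x ⇒ y) := by rw [neg_imp_imp_self_left y x]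

theorem zero_imp_imp_imp_imp_self (x y w : A) : ((0 ⇒ x) ⇒ y) ⇒ (w ⇒ x) = y ⇒ (w ⇒ x) := by
  calc ((0 ⇒ x) ⇒ y) ⇒ (w ⇒ x)
    _ = ((0 ⇒ ∼∼x) ⇒ y) ⇒ (w ⇒ x) := by rw [neg_neg x]
    _ = ((∼x ⇒ ∼0) ⇒ y) ⇒ (w ⇒ x) := by rw [zero_imp_neg ∼x]
    _ = (0 ⇒ ((w ⇒ x) ⇒ ∼x)) ⇒ (y ⇒ (w ⇒ x)) := by rw [zero_imp_imp_imp_imp (w ⇒ x) ∼x y]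
    _ = y ⇒ (w ⇒ x) := by
      rw [imp_imp_neg_right w x, zero_imp_imp_neg_imp_self x w, zero_imp_neg_imp_imp (w ⇒ x) y]

theorem neg_imp_imp_neg_zero_imp (x y w : A) :
    ∼((x ⇒ y) ⇒ ∼(0 ⇒ w)) = x ⇒ ∼(y ⇒ ∼(0 ⇒ w)) := by
  calc ∼((x ⇒ y) ⇒ ∼(0 ⇒ w))
    _ = ((0 ⇒ ∼(0 ⇒ ∼w)) ⇒ x) ⇒ (∼y ⇒ ∼(0 ⇒ ∼w)) := by
      rw [neg_imp_neg_zero_imp_neg_eq y w, zero_imp_neg_zero_imp ∼w, neg_neg w,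
        imp_imp_neg_imp_neg (0 ⇒ w) x y]
    _ = x ⇒ ∼(y ⇒ ∼(0 ⇒ w)) := by
      rw [zero_imp_imp_imp_imp_self ∼(0 ⇒ ∼w) x ∼y, neg_imp_neg_zero_imp_neg_eq y w]

theorem neg_imp_self_right (x y : A) : ∼(x ⇒ y) ⇒ y = x ⇒ y := by
  rw [← neg_neg (∼(x ⇒ y) ⇒ y), ← imp_imp_neg_zero_imp_eq x y, neg_imp_imp_neg_zero_imp x y y,
    ← neg_imp_imp_self_left y 0, neg_imp_self y, neg_neg y]

theorem imp_imp_neg_zero_imp (x y : A) : (x ⇒ y) ⇒ ∼(0 ⇒ y) = ∼(x ⇒ y) := by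
  rw [imp_imp_neg_zero_imp_eq x y, neg_imp_self_right x y]

theorem imp_imp_zero_imp_imp (x y w : A) : (x ⇒ y) ⇒ ((0 ⇒ y) ⇒ w) = (x ⇒ y) ⇒ w := by
  rw [← neg_neg ((0 ⇒ y) ⇒ w), ← imp_neg_zero_imp_imp w y,
    ← neg_imp_imp_neg_zero_imp (x ⇒ y) w (y ⇒ w),
    ← neg_imp_neg_zero_imp_neg_eq ((x ⇒ y) ⇒ w) (y ⇒ w), ← neg_imp_imp_neg_imp w x y,
    imp_imp_neg_zero_imp (∼w ⇒ x) ∼(y ⇒ w), neg_imp_imp_neg_imp w x y, neg_neg ((x ⇒ y) ⇒ w)]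

theorem imp_imp_imp_imp_imp (x y w u : A) :
    (x ⇒ y) ⇒ ((w ⇒ y) ⇒ (u ⇒ w)) = (x ⇒ y) ⇒ (u ⇒ w) := by
  rw [← neg_imp_self_right (w ⇒ y) (u ⇒ w), ← neg_neg (u ⇒ w),
    ← imp_imp_neg_imp_neg ∼(u ⇒ w) w y, neg_imp_self_right u w, neg_neg (u ⇒ w),
    ← neg_zero_imp_imp y (u ⇒ w), neg_imp_self_right (0 ⇒ y) (u ⇒ w),
    imp_imp_zero_imp_imp x y (u ⇒ w)]

end InvolutiveIZroupoid

/-- In an involutive implication zroupoid (an I-zroupoid satisfying x'' = x),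
the identity (x → y) → ((z → y) → (u → z)) = (x → y) → (u → z) holds. -/
theorem stmt_0 {A : Type*} (f : A → A → A) (z : A)
    (hI : ∀ x y w : A, f (f x y) w = f (f (f (f w z) x) (f (f y w) z)) z)
    (hI0 : f (f z z) z = z)
    (hinv : ∀ x : A, f (f x z) z = x) :
    ∀ x y w u : A, f (f x y) (f (f w y) (f u w)) = f (f x y) (f u w) := by
  let _ : InvolutiveIZroupoid A := { zero := z, imp := f, imp_imp := hI, neg_neg := hinv }
  exact InvolutiveIZroupoid.imp_imp_imp_imp_imp
end

section
/- Let A be a symmetric implication zroupoid such that A satisfies 0 → (x → x) = x → x for all x. Then A satisfies the identity (x → y) → (x → y) = (x → x) → (y → y) for all x, y in A. -/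
/-- Two commutative idempotent operations with units, each distributing over the other.
Associativity is a consequence: see `IsUnitalDistrib.join_assoc`. -/
structure IsUnitalDistrib {A : Type*} (m j : A → A → A) (o e : A) : Prop where
  meet_comm : ∀ x y, m x y = m y x
  join_comm : ∀ x y, j x y = j y x
  meet_self : ∀ x, m x x = x
  join_self : ∀ x, j x x = x
  meet_one : ∀ x, m x e = x
  join_zero : ∀ x, j x o = x
  meet_join : ∀ x y w, m x (j y w) = j (m x y) (m x w)
  join_meet : ∀ x y w, j x (m y w) = m (j x y) (j x w)

namespace IsUnitalDistrib

variable {A : Type*} {m j : A → A → A} {o e : A}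

theorem dual (h : IsUnitalDistrib m j o e) : IsUnitalDistrib j m e o :=
  ⟨h.join_comm, h.meet_comm, h.join_self, h.meet_self, h.join_zero, h.meet_one,
    h.join_meet, h.meet_join⟩

theorem join_meet_self (h : IsUnitalDistrib m j o e) (x y : A) :
    j x (m x y) = m x (j e y) := by
  rw [h.meet_join, h.meet_one]

theorem meet_join_self (h : IsUnitalDistrib m j o e) (x y : A) :
    m x (j x y) = m x (j e y) := by
  rw [h.meet_join, h.meet_self, h.join_meet_self]

theorem meet_one_join_self (h : IsUnitalDistrib m j o e) (x : A) : m x (j e x) = x := by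
  rw [← h.join_meet_self, h.meet_self, h.join_self]

theorem join_zero_meet (h : IsUnitalDistrib m j o e) (x y : A) :
    j x (m o y) = m x (j e y) := by
  rw [h.join_meet, h.join_zero, h.meet_join_self]

theorem one_join_zero_meet (h : IsUnitalDistrib m j o e) (x : A) : j e (m o x) = j e x := by
  rw [h.join_zero_meet, h.meet_comm, h.meet_one]

theorem one_join_one_join (h : IsUnitalDistrib m j o e) (x : A) : j e (j e x) = j e x := by
  rw [← h.one_join_zero_meet (j e x), h.dual.one_join_zero_meet, h.one_join_zero_meet]

/-- On elements above the unit of the meet the two operations agree. -/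
theorem one_join_join_one_join (h : IsUnitalDistrib m j o e) (x y : A) :
    j (j e x) (j e y) = m (j e x) (j e y) := by
  have key : ∀ x y, m (j e x) (j (j e x) (j e y)) = m (j e x) (j e y) := fun x y => by
    rw [h.meet_join_self, h.one_join_one_join]
  calc j (j e x) (j e y)
      = j (m (j e x) (j (j e x) (j e y))) (m (j e y) (j (j e x) (j e y))) := by
        rw [h.meet_comm (j e x), h.meet_comm (j e y), ← h.meet_join, h.meet_self]
    _ = m (j e x) (j e y) := by
        rw [key, h.join_comm (j e x), key, h.meet_comm (j e y), h.join_self]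

theorem one_join_join (h : IsUnitalDistrib m j o e) (x y : A) :
    j e (j x y) = m (j e x) (j e y) := by
  rw [← h.one_join_zero_meet (j x y), h.meet_join, ← h.dual.one_join_join_one_join,
    h.join_meet, h.one_join_zero_meet, h.one_join_zero_meet]

theorem one_join_join_assoc (h : IsUnitalDistrib m j o e) (x y : A) :
    j (j e x) y = j e (j x y) := by
  have h_meet_left : m (j e x) (j e (j x y)) = j e (j x y) := by
    rw [h.one_join_join, ← h.join_meet, ← h.join_meet, h.join_meet e x, h.join_meet e x,
      ← h.one_join_join_one_join x y, h.meet_join_self, h.one_join_one_join,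
      h.one_join_join_one_join]
  have h_meet_right : m (j e y) (j e (j x y)) = j e (j x y) := by
    rw [h.one_join_join, h.meet_comm (j e x), ← h.one_join_join_one_join y x,
      h.meet_join_self, h.one_join_one_join, h.one_join_join_one_join]
  have h_meet : m (j e x) (j (j e x) y) = j e (j x y) := by
    rw [h.meet_join_self, h.one_join_join]
  have h_join : j (j e (j x y)) (j e x) = j e (j x y) := by
    rw [h.one_join_join_one_join, h.meet_comm, h_meet_left]
  have h_split : j (j e x) y = j (j e (j x y)) (m y (j e x)) := by
    calc j (j e x) y = m (j (j e x) y) (j (j e x) y) := (h.meet_self _).symm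
      _ = j (m (j (j e x) y) (j e x)) (m (j (j e x) y) y) := h.meet_join _ _ _
      _ = j (j e (j x y)) (m y (j e x)) := by
        rw [h.meet_comm _ (j e x), h_meet, h.meet_comm _ y, h.join_comm (j e x) y,
          h.meet_join_self, h.one_join_one_join]
  rw [h_split, h.join_meet, h_join, h.meet_comm, h.meet_join_self, h.meet_comm, h_meet_right]

theorem join_assoc (h : IsUnitalDistrib m j o e) (a b c : A) :
    j (j a b) c = j a (j b c) := by
  have ha : ∀ a b c, m a (j (j a b) c) = m a (j a (j b c)) := fun a b c => by
    rw [h.meet_join_self, ← h.one_join_join_assoc, h.meet_join, h.meet_join_self, ← h.meet_join]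
  have hb : m b (j (j a b) c) = m b (j a (j b c)) := by
    rw [h.meet_join, h.join_comm a b, h.meet_join_self, ← h.meet_join, h.one_join_join_assoc,
      h.meet_join b a, h.meet_join_self, ← h.meet_join, h.join_comm a (j e c),
      h.one_join_join_assoc, h.join_comm c a]
  have hc : m c (j (j a b) c) = m c (j a (j b c)) := by
    rw [h.join_comm _ c, h.join_comm a b, h.join_comm a, h.join_comm b c, ← ha]
  calc j (j a b) c
      = m (j (j a b) c) (j (j a b) c) := (h.meet_self _).symm
    _ = j (j (m a (j (j a b) c)) (m b (j (j a b) c))) (m c (j (j a b) c)) := by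
        simp only [h.meet_comm _ (j (j a b) c), ← h.meet_join]
    _ = m (j (j a b) c) (j a (j b c)) := by
        rw [ha, hb, hc]
        simp only [h.meet_comm _ (j a (j b c)), ← h.meet_join]
    _ = j (m a (j (j a b) c)) (j (m b (j (j a b) c)) (m c (j (j a b) c))) := by
        simp only [h.meet_comm _ (j (j a b) c), ← h.meet_join]
    _ = m (j a (j b c)) (j a (j b c)) := by
        rw [ha, hb, hc]
        simp only [h.meet_comm _ (j a (j b c)), ← h.meet_join]
    _ = j a (j b c) := h.meet_self _

/-- If `x ∨ x'` and `y ∨ y'` lie above the unit of the meet, then the De Morgan complement pair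
`x ∧ y'`, `x' ∨ y` has the same join as `x ∧ x'` and `y ∨ y'`. -/
theorem meet_eq_meet_of_one_join (h : IsUnitalDistrib m j o e) {x x' y y' : A}
    (hx : j e (j x x') = j x x') (hy : j e (j y y') = j y y') :
    j (m x y') (j x' y) = j (m x x') (j y y') := by
  have hmeet : ∀ {a b : A}, j e a = a → j e b = b → m a b = j a b := fun {a b} ha hb => by
    have := h.one_join_join_one_join a b
    rw [ha, hb] at this
    exact this.symm
  have hxj : ∀ w, j e (j (j x x') w) = j (j x x') w := fun w => by
    rw [← h.join_assoc, hx]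
  have hyj : ∀ w, j e (j (j y y') w) = j (j y y') w := fun w => by
    rw [← h.join_assoc, hy]
  have : Std.Associative j := ⟨h.join_assoc⟩
  have : Std.Commutative j := ⟨h.join_comm⟩
  have : Std.IdempotentOp j := ⟨h.join_self⟩
  calc j (m x y') (j x' y)
      = m (j (j x' y) x) (j (j x' y) y') := by rw [h.join_comm, h.join_meet]
    _ = m (j (j x x') y) (j (j y y') x') := by
        congr 1 <;> ac_rfl
    _ = j (j (j x x') y) (j (j y y') x') := hmeet (hxj _) (hyj _)
    _ = j (j (j y y') x) (j (j y y') x') := by ac_rfl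
    _ = m (j (j y y') x) (j (j y y') x') := (hmeet (hyj _) (hyj _)).symm
    _ = j (m x x') (j y y') := by rw [← h.join_meet, h.join_comm]

end IsUnitalDistrib

/-- The operations `x ∧ y = (x → y')'` and `x ∨ y = x' → y` of a symmetric implication zroupoid. -/
theorem isUnitalDistrib_of_symmetric {A : Type*} (f : A → A → A) (z : A)
    (hI : ∀ x y w : A, f (f x y) w = f (f (f (f w z) x) (f (f y w) z)) z)
    (hinv : ∀ x : A, f (f x z) z = x)
    (hsym : ∀ x y : A, f (f x (f y z)) z = f (f y (f x z)) z) :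
    IsUnitalDistrib (fun x y => f (f x (f y z)) z) (fun x y => f (f x z) y) z (f z z) := by
  have hcontra : ∀ x y, f x (f y z) = f y (f x z) := fun x y => by
    rw [← hinv (f x (f y z)), hsym, hinv]
  have hjc : ∀ x y, f (f x z) y = f (f y z) x := fun x y => by
    have := hcontra (f x z) (f y z)
    rwa [hinv, hinv] at this
  have hjm : ∀ x y w, f (f x z) (f (f y (f w z)) z)
      = f (f (f (f x z) y) (f (f (f x z) w) z)) z := fun x y w => by
    rw [hjc x, hinv, hI, hjc x w]
  have hmj : ∀ x y w, f (f x (f (f (f y z) w) z)) z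
      = f (f (f (f x (f y z)) z) z) (f (f x (f w z)) z) := fun x y w => by
    have := hjm (f x z) (f y z) (f w z)
    simp only [hinv] at this
    rw [this]
    simp only [hinv]
  have hone : ∀ x, f (f z z) x = x := fun x => by rw [hjc, hinv]
  have hself : ∀ x, f (f x (f x z)) z = x := fun x => by
    have h_one : f z (f z z) = f z z := by
      have := hjm (f z z) z (f z z)
      simp only [hinv, hone] at this
      exact this.symm
    have := hjm x z z
    simp only [h_one, hinv] at this
    exact this.symm
  refine ⟨hsym, hjc, hself, fun x => ?_, fun x => ?_, fun x => ?_, hmj, hjm⟩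
  · have := hself (f x z)
    rw [hinv] at this
    rw [← hinv (f (f x z) x), this, hinv]
  · simp only [hinv]
  · exact hinv x

/-- A symmetric I-zroupoid satisfying 0 → (x → x) = x → x satisfies
(x → y) → (x → y) = (x → x) → (y → y). -/
theorem stmt_2 {A : Type*} (f : A → A → A) (z : A)
    (hI : ∀ x y w : A, f (f x y) w = f (f (f (f w z) x) (f (f y w) z)) z)
    (hI0 : f (f z z) z = z)
    (hinv : ∀ x : A, f (f x z) z = x)
    (hsym : ∀ x y : A, f (f x (f y z)) z = f (f y (f x z)) z)
    (hyp : ∀ x : A, f z (f x x) = f x x) :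
    ∀ x y : A, f (f x y) (f x y) = f (f x x) (f y y) := by
  intro x y
  have h := isUnitalDistrib_of_symmetric f z hI hinv hsym
  have hx : f (f (f z z) z) (f (f x z) (f x z)) = f (f x z) (f x z) := by
    rw [hI0, hyp]
  have hy : f (f (f z z) z) (f (f y z) (f y z)) = f (f y z) (f y z) := by
    rw [hI0, hyp]
  have := h.meet_eq_meet_of_one_join hx hy
  have hyy : f (f y z) (f y z) = f y y := by
    simpa only [hinv] using h.join_comm y (f y z)
  simpa only [hinv, hyy] using this
end

section
/- Every symmetric implication zroupoid A satisfies the following eight identities, for all x, y, z in A: (1) (x → x) → (x → x) = x → (x → (x → x)); (2) ((x → x) → x) → x = x → (x → (x → x)); (3) (x → y) → (y → z) = ((y → x) → y) → z; (4) y → ((x → y) → z) = ((y → x) → y) → z; (5) (x → x) → (x → y) = x → ((x → x) → y); (6) x → ((x → x) → y) = ((x → x) → x) → y; (7) x → ((y → x) → x) = ((x → y) → x) → x; (8) x → ((y → x) → y) = ((x → y) → x) → y. -/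
/-- Two commutative operations with units, each distributing over the other. -/
structure DistribPair {A : Type*} (m p : A → A → A) (e o : A) : Prop where
  mul_comm : ∀ x y, m x y = m y x
  add_comm : ∀ x y, p x y = p y x
  mul_add : ∀ x y w, m x (p y w) = p (m x y) (m x w)
  add_mul : ∀ x y w, p x (m y w) = m (p x y) (p x w)
  mul_one : ∀ x, m x e = x
  add_zero : ∀ x, p x o = x

namespace DistribPair

variable {A : Type*} {m p : A → A → A} {e o : A}

local notation:70 x:70 "⊙" y:71 => m x y
local notation:65 x:65 "∔" y:66 => p x y

theorem dual (h : DistribPair m p e o) : DistribPair p m o e :=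
  ⟨h.add_comm, h.mul_comm, h.add_mul, h.mul_add, h.add_zero, h.mul_one⟩

theorem one_mul (h : DistribPair m p e o) (x : A) : e ⊙ x = x := by
  rw [h.mul_comm, h.mul_one]

theorem mul_self_add_self (h : DistribPair m p e o) (x : A) : x ⊙ x ∔ x = x := by
  calc x ⊙ x ∔ x = x ⊙ (x ∔ e) := by rw [h.mul_add, h.mul_one]
    _ = (x ∔ o) ⊙ (x ∔ e) := by rw [h.add_zero]
    _ = x := by rw [← h.add_mul, h.mul_one, h.add_zero]

theorem mul_self (h : DistribPair m p e o) (x : A) : x ⊙ x = x := by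
  have he : e ∔ e = e := by simpa only [h.mul_one] using h.mul_self_add_self e
  calc x ⊙ x = x ⊙ x ⊙ (e ∔ e) := by rw [he, h.mul_one]
    _ = x ⊙ x ∔ x ⊙ x := by rw [h.mul_add, h.mul_one]
    _ = (x ∔ x) ⊙ x := by rw [← h.mul_add, h.mul_comm]
    _ = x := h.dual.mul_self_add_self x

theorem mul_self_add (h : DistribPair m p e o) (x y : A) : x ⊙ (x ∔ y) = x ∔ x ⊙ y := by
  rw [h.mul_add, h.mul_self]

theorem mul_one_add (h : DistribPair m p e o) (x y : A) : x ⊙ (e ∔ y) = x ∔ x ⊙ y := by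
  rw [h.mul_add, h.mul_one]

theorem mul_self_add_eq (h : DistribPair m p e o) (x y : A) : x ⊙ (x ∔ y) = x ⊙ (e ∔ y) := by
  rw [h.mul_self_add, h.mul_one_add]

theorem mul_one_add_eq_add_zero_mul (h : DistribPair m p e o) (x y : A) :
    x ⊙ (e ∔ y) = x ∔ o ⊙ y := by
  rw [h.dual.mul_one_add, h.mul_self_add_eq]

theorem add_mul_one_add (h : DistribPair m p e o) (x y : A) : x ∔ y ⊙ (e ∔ x) = x ∔ y := by
  calc x ∔ y ⊙ (e ∔ x) = x ∔ y ⊙ (x ∔ y) := by rw [← h.mul_self_add_eq, h.add_comm x y]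
    _ = (x ∔ y) ⊙ (x ∔ y ∔ x) := by rw [h.add_mul, h.add_comm x (x ∔ y)]
    _ = (x ∔ y) ⊙ (x ∔ e) := by rw [h.mul_self_add_eq, h.add_comm x e]
    _ = x ∔ y := by rw [← h.add_mul, h.mul_one]

theorem mul_mul_one_add (h : DistribPair m p e o) (x y : A) : x ⊙ (y ⊙ (e ∔ x)) = x ⊙ y := by
  rw [h.mul_one_add_eq_add_zero_mul, h.dual.add_mul_one_add]

theorem self_add_one_add (h : DistribPair m p e o) (x : A) : x ∔ (e ∔ x) = e ∔ x := by
  simpa only [h.one_mul, h.add_comm x e] using h.add_mul_one_add x e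

theorem mul_one_add_one_add (h : DistribPair m p e o) (x y : A) :
    x ⊙ (e ∔ (e ∔ y)) = x ⊙ (e ∔ y) := by
  rw [h.mul_one_add_eq_add_zero_mul, ← h.mul_self_add_eq, h.dual.one_mul,
    ← h.mul_one_add_eq_add_zero_mul]

theorem one_add_one_add (h : DistribPair m p e o) (x : A) : e ∔ (e ∔ x) = e ∔ x := by
  simpa only [h.one_mul] using h.mul_one_add_one_add e x

theorem one_add_add (h : DistribPair m p e o) (x y : A) : e ∔ x ∔ y = e ∔ x ⊙ y := by
  calc e ∔ x ∔ y = e ∔ x ∔ y ⊙ (e ∔ (e ∔ x)) := by rw [h.add_mul_one_add]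
    _ = (e ∔ x) ⊙ (e ∔ x ∔ y) := by rw [h.one_add_one_add, h.mul_self_add, h.mul_comm y]
    _ = e ∔ x ⊙ y := by rw [h.mul_self_add_eq, ← h.add_mul]

theorem mul_one_add_mul (h : DistribPair m p e o) (x y : A) :
    y ⊙ (e ∔ x ⊙ y) = y ⊙ (e ∔ x) := by
  rw [← h.one_add_add, h.add_comm, h.mul_self_add_eq, h.one_add_one_add]

theorem mul_mul_one_add_left (h : DistribPair m p e o) (x y : A) :
    x ⊙ y ⊙ (e ∔ x) = x ⊙ y := by
  rw [h.mul_one_add_eq_add_zero_mul, h.mul_comm o, ← h.mul_add, h.add_zero]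

theorem add_mul_mul_one_add (h : DistribPair m p e o) (x y : A) :
    (x ∔ y) ⊙ (y ⊙ (e ∔ x)) = y ⊙ (e ∔ x) := by
  calc (x ∔ y) ⊙ (y ⊙ (e ∔ x)) = y ⊙ (e ∔ x) ⊙ (y ⊙ (e ∔ x) ∔ x) := by
        rw [← h.add_mul_one_add x y, h.mul_comm, h.add_comm x (y ⊙ (e ∔ x))]
    _ = y ⊙ (e ∔ x) ∔ y ⊙ x := by
        rw [h.mul_self_add, h.mul_comm _ x, h.mul_mul_one_add, h.mul_comm x y]
    _ = y ⊙ (e ∔ x) := by rw [← h.mul_add, h.add_comm _ x, h.self_add_one_add]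

theorem mul_self_mul (h : DistribPair m p e o) (x y : A) : x ⊙ (x ⊙ y) = x ⊙ y := by
  calc x ⊙ (x ⊙ y) = x ⊙ y ⊙ (x ⊙ (e ∔ x ⊙ y)) := by rw [h.mul_mul_one_add, h.mul_comm x (x ⊙ y)]
    _ = x ⊙ y ⊙ (x ∔ x ⊙ y) := by
        rw [h.mul_comm x y, h.mul_one_add_mul, h.mul_one_add, h.mul_comm x y]
    _ = (x ∔ x ⊙ y) ⊙ (x ⊙ y ⊙ (e ∔ x)) := by rw [h.mul_mul_one_add_left, h.mul_comm]
    _ = x ⊙ y := by rw [h.add_mul_mul_one_add, h.mul_mul_one_add_left]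

theorem add_self_add (h : DistribPair m p e o) (x y : A) : x ∔ (x ∔ y) = x ∔ y :=
  h.dual.mul_self_mul x y

theorem one_add_mul_add (h : DistribPair m p e o) (x y w : A) :
    (e ∔ y) ⊙ (x ∔ w) = x ∔ (e ∔ y) ⊙ w := by
  have add_mul_eq : ∀ a c, x ∔ a ∔ c ⊙ a = (x ∔ a) ⊙ (e ∔ c) := fun a c => by
    rw [h.add_mul, h.add_comm (x ∔ a) a, h.add_comm x a, h.add_self_add, h.mul_comm,
      h.mul_self_add_eq]
  symm
  calc x ∔ (e ∔ y) ⊙ w = x ∔ (e ∔ y) ⊙ w ∔ (e ∔ y) ⊙ ((e ∔ y) ⊙ w) := by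
        rw [h.mul_self_mul, h.add_comm x, h.add_comm _ ((e ∔ y) ⊙ w), h.add_self_add]
    _ = (e ∔ y) ⊙ (x ∔ (e ∔ y) ⊙ w) := by rw [add_mul_eq, h.one_add_one_add, h.mul_comm]
    _ = (e ∔ y) ⊙ (x ∔ w) := by rw [h.mul_add, h.mul_self_mul, ← h.mul_add]

theorem one_add_mul_add_add (h : DistribPair m p e o) (x y w : A) :
    (e ∔ x) ⊙ (y ∔ (x ∔ w)) = y ∔ (x ∔ w) := by
  rw [h.one_add_mul_add, h.add_comm e x, ← h.add_mul, h.one_mul]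

theorem add_add_mul (h : DistribPair m p e o) (x y w : A) :
    x ∔ (y ∔ x ⊙ w) = (e ∔ w) ⊙ (x ∔ y) := by
  calc x ∔ (y ∔ x ⊙ w) = (x ∔ (x ∔ y)) ⊙ (x ∔ (y ∔ w)) := by
        rw [h.add_mul, h.add_mul, h.add_comm y x]
    _ = x ∔ y ⊙ (e ∔ w) := by rw [h.add_self_add, ← h.add_mul, h.mul_self_add_eq]
    _ = (e ∔ w) ⊙ (x ∔ y) := by rw [h.one_add_mul_add, h.mul_comm y]

theorem add_add_eq_add_add_add (h : DistribPair m p e o) (x y w : A) :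
    x ∔ (y ∔ w) = y ∔ w ∔ (x ∔ y) := by
  calc x ∔ (y ∔ w) = (e ∔ y) ⊙ (y ∔ w ∔ x) := by
        rw [h.add_comm _ x, h.one_add_mul_add_add]
    _ = y ∔ w ∔ (x ∔ y ⊙ (e ∔ w)) := by rw [← h.add_add_mul, h.mul_comm _ y, h.mul_self_add_eq]
    _ = y ∔ w ∔ (e ∔ w) ⊙ (x ∔ y) := by rw [h.one_add_mul_add, h.mul_comm y]
    _ = y ∔ w ∔ (x ∔ y) := by
        rw [← h.one_add_mul_add, h.add_comm _ (x ∔ y), h.add_comm y w, h.one_add_mul_add_add]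

theorem add_assoc (h : DistribPair m p e o) (x y w : A) : x ∔ y ∔ w = x ∔ (y ∔ w) := by
  rw [h.add_add_eq_add_add_add x y w, h.add_comm _ w, h.add_comm x y,
    h.add_add_eq_add_add_add w y x, h.add_comm w y, h.add_comm (y ∔ x)]

theorem add_left_comm (h : DistribPair m p e o) (x y w : A) : x ∔ (y ∔ w) = y ∔ (x ∔ w) := by
  rw [← h.add_assoc, h.add_comm x y, h.add_assoc]

end DistribPair

/-- The derived meet `(x → y')'` and join `x' → y` of a symmetric I-zroupoid. -/
theorem distribPair_of_symmetric {A : Type*} {f : A → A → A} {z : A}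
    (hI : ∀ x y w : A, f (f x y) w = f (f (f (f w z) x) (f (f y w) z)) z)
    (hinv : ∀ x : A, f (f x z) z = x)
    (hsym : ∀ x y : A, f (f x (f y z)) z = f (f y (f x z)) z) :
    DistribPair (fun x y => f (f x (f y z)) z) (fun x y => f (f x z) y) (f z z) z := by
  have add_comm : ∀ x y, f (f x z) y = f (f y z) x := fun x y => by
    have := congrArg (f · z) (hsym (f x z) (f y z))
    simpa only [hinv] using this
  have add_mul : ∀ x y w,
      f (f x z) (f (f y (f w z)) z) = f (f (f (f x z) y) (f (f (f x z) w) z)) z := fun x y w => by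
    rw [add_comm x, hinv, hI, add_comm w x]
  refine ⟨hsym, add_comm, fun x y w => ?_, add_mul, fun x => ?_, fun x => hinv x⟩
  · have := congrArg (f · z) (add_mul (f x z) (f y z) (f w z))
    simpa only [hinv] using this
  · simp only [hinv]

/-- Every symmetric I-zroupoid satisfies the eight listed identities. -/
theorem stmt_6 {A : Type*} (f : A → A → A) (z : A)
    (hI : ∀ x y w : A, f (f x y) w = f (f (f (f w z) x) (f (f y w) z)) z)
    (hI0 : f (f z z) z = z)
    (hinv : ∀ x : A, f (f x z) z = x)
    (hsym : ∀ x y : A, f (f x (f y z)) z = f (f y (f x z)) z) :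
    (∀ x : A, f (f x x) (f x x) = f x (f x (f x x))) ∧
    (∀ x : A, f (f (f x x) x) x = f x (f x (f x x))) ∧
    (∀ x y w : A, f (f x y) (f y w) = f (f (f y x) y) w) ∧
    (∀ x y w : A, f y (f (f x y) w) = f (f (f y x) y) w) ∧
    (∀ x y : A, f (f x x) (f x y) = f x (f (f x x) y)) ∧
    (∀ x y : A, f x (f (f x x) y) = f (f (f x x) x) y) ∧
    (∀ x y : A, f x (f (f y x) x) = f (f (f x y) x) x) ∧
    (∀ x y : A, f x (f (f y x) y) = f (f (f x y) x) y) := by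
  have h := distribPair_of_symmetric hI hinv hsym
  have exchange : ∀ x y w, f x (f y w) = f y (f x w) := fun x y w => by
    simpa only [hinv] using h.add_left_comm (f x z) (f y z) w
  have contract : ∀ x y, f x (f x y) = f x y := fun x y => by
    simpa only [hinv] using h.add_self_add (f x z) y
  have key : ∀ x y w, f (f (f y x) y) w = f y (f (f x y) w) := fun x y w => by
    have h1 := h.add_assoc (f y z) (f (f x y) z) w
    have h2 := h.mul_self_add (f y z) x
    have h3 := h.mul_comm (f y z) x
    simp only [hinv] at h1 h2 h3
    rw [← h1, ← h3, ← h2, ← hsym, hinv, hinv]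
  have self : ∀ x, f x (f (f x x) x) = f x x := fun x => by
    have h1 := h.add_mul_one_add x (f x z)
    have h2 := h.mul_one_add (f x z) x
    have h3 := h.mul_comm (f x z) x
    have h4 := h.add_comm x (f x z)
    have h5 := h.add_comm x (f (f x x) z)
    simp only [hinv] at h1 h2 h3 h4 h5
    rw [← h5, exchange, ← h3, ← h2, h1, h4]
  exact ⟨fun x => by rw [exchange, self, contract, contract],
    fun x => by rw [key, self, contract, contract],
    fun x y w => by rw [exchange, key], fun x y w => (key x y w).symm,
    fun x y => exchange _ _ _, fun x y => (key x x y).symm,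
    fun x y => (key y x x).symm, fun x y => (key y x y).symm⟩
end

section
/- Let A be a symmetric implication zroupoid. Then the following conditions are equivalent: (a) A satisfies (31A12): x → (x → x) = (x → x) → x for all x; (b) A satisfies (41A14): x → (x → (x → x)) = (x → (x → x)) → x for all x; (c) A satisfies (41A34): (x → x) → (x → x) = (x → (x → x)) → x for all x; (d) A satisfies (41A45): (x → (x → x)) → x = ((x → x) → x) → x for all x; (e) A satisfies x → x = (x → x) → x for all x. -/
section Bidistributive

variable {A : Type*} {m a : A → A → A} {o e : A}

/-- If two unital operations `m` and `a` distribute over each other from the left and `m` is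
commutative, then `a` is idempotent. -/
theorem bidistributive_idem (hm : ∀ x y, m x y = m y x)
    (ho : ∀ x, m x o = x) (he : ∀ x, a x e = x)
    (hma : ∀ x y w, m x (a y w) = a (m x y) (m x w))
    (ham : ∀ x y w, a x (m y w) = m (a x y) (a x w)) (x : A) : a x x = x := by
  have hoo : a o o = o := by
    calc a o o = m o (a o o) := by rw [hm, ho]
      _ = m (a o e) (a o o) := by rw [he]
      _ = a o (m e o) := (ham o e o).symm
      _ = o := by rw [ho, he]
  calc a x x = a (m x o) (m x o) := by rw [ho]
    _ = m x (a o o) := (hma x o o).symm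
    _ = x := by rw [hoo, ho]

/-- If two commutative unital operations `m` and `a` distribute over each other, then `a`
satisfies the left alternative law. -/
theorem bidistributive_left_alt (hm : ∀ x y, m x y = m y x) (ha : ∀ x y, a x y = a y x)
    (ho : ∀ x, m x o = x) (he : ∀ x, a x e = x)
    (hma : ∀ x y w, m x (a y w) = a (m x y) (m x w))
    (ham : ∀ x y w, a x (m y w) = m (a x y) (a x w)) (x y : A) :
    a x (a x y) = a x y := by
  have ia := bidistributive_idem hm ho he hma ham
  have im := bidistributive_idem ha he ho ham hma
  have absorb (x y : A) : a x (m x y) = m x (a o y) := by rw [hma, ho]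
  have absorb_zero (x y : A) : a x (m x y) = a x (m e y) := by rw [ham, ham, ia, he]
  have one_add (y : A) : a o (m e y) = a o y := by
    rw [← absorb_zero, hm, ho]
  have one_alt (y : A) : a o (a o y) = a o y := by
    rw [← one_add (a o y), hma, ho, ha e, he, one_add]
  have mul_left : m x (a x (a x y)) = m x (a x y) := by
    have h : m x (a x y) = m x (a o y) := by rw [hma, im, absorb]
    rw [hma, im, h, absorb, one_alt]
  have mul_right : m y (a x (a x y)) = m y (a x y) := by
    have h : m y (a x y) = m y (a o x) := by rw [hma, im, ha, absorb]
    rw [hma, h, ← hma, ha o x]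
    have h' : a x (a x o) = a x o := by
      have hx : m (a x o) x = x := by rw [hm, hma, im, ho, ia]
      calc a x (a x o) = a (m (a x o) x) (m (a x o) o) := by rw [hx, ho]
        _ = a x o := by rw [← hma, im]
    rw [h']
  have mul_self : m (a x (a x y)) (a x y) = a x y := by
    rw [hma, hm _ x, hm _ y, mul_left, mul_right, hm x, hm y, ← hma, im]
  calc a x (a x y) = m (a x (a x y)) (a x (a x y)) := (im _).symm
    _ = a (m (a x (a x y)) x) (m (a x (a x y)) (a x y)) := hma _ _ _
    _ = a (m (a x y) x) (a x y) := by rw [mul_self, hm _ x, mul_left, hm x]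
    _ = m (a x y) (a o x) := by rw [ha, absorb]
    _ = a x y := by rw [ha o, hm, ← ham, hm, ho]

end Bidistributive

/-- In a symmetric I-zroupoid, the identities (31A12), (41A14), (41A34),
(41A45) and x → x = (x → x) → x are all equivalent. -/
theorem stmt_10 {A : Type*} (f : A → A → A) (z : A)
    (hI : ∀ x y w : A, f (f x y) w = f (f (f (f w z) x) (f (f y w) z)) z)
    (hI0 : f (f z z) z = z)
    (hinv : ∀ x : A, f (f x z) z = x)
    (hsym : ∀ x y : A, f (f x (f y z)) z = f (f y (f x z)) z) :
    ((∀ x : A, f x (f x x) = f (f x x) x) ↔ (∀ x : A, f x x = f (f x x) x)) ∧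
    ((∀ x : A, f x (f x (f x x)) = f (f x (f x x)) x) ↔
      (∀ x : A, f x x = f (f x x) x)) ∧
    ((∀ x : A, f (f x x) (f x x) = f (f x (f x x)) x) ↔
      (∀ x : A, f x x = f (f x x) x)) ∧
    ((∀ x : A, f (f x (f x x)) x = f (f (f x x) x) x) ↔
      (∀ x : A, f x x = f (f x x) x)) := by
  set n : A → A := fun x => f x z with hn
  set m : A → A → A := fun x y => n (f x (n y)) with hmd
  set a : A → A → A := fun x y => f (n x) y with had
  have nn (x : A) : n (n x) = x := hinv x
  have nm (x y : A) : n (m x y) = a (n x) (n y) := by simp [hmd, had, nn]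
  have na (x y : A) : n (a x y) = m (n x) (n y) := by simp [hmd, had, nn]
  have hm (x y : A) : m x y = m y x := hsym x y
  have ha (x y : A) : a x y = a y x := by rw [← nn (a x y), na, hm, nm, nn, nn]
  have ho (x : A) : m x (n z) = x := by simp [hmd, hn, hI0, hinv]
  have he (x : A) : a x z = x := hinv x
  have ham (x y w : A) : a x (m y w) = m (a x y) (a x w) := by
    have h := hI y (n w) x
    rw [ha x (m y w), ha x w]
    simpa [had, hmd, hn, hinv] using h
  have hma (x y w : A) : m x (a y w) = a (m x y) (m x w) := by
    rw [← nn (m x (a y w)), nm, na y w, ham, nm, na, na, nn, nn, nn]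
  have im := bidistributive_idem ha he ho ham hma
  have alt := bidistributive_left_alt hm ha ho he hma ham
  have hf (x y : A) : f x y = a (n x) y := by simp only [had, nn]
  have f_alt (x : A) : f x (f x x) = f x x := by
    rw [hf, hf, alt]
  have alt_right (x : A) : a x (f x x) = f x x := by rw [hf, ha (n x) x, alt]
  have f_self (x : A) : f (f x x) (f x x) = f x x := by
    rw [hf (f x x), show n (f x x) = m x (n x) by rw [hf, na, nn], ha, ham, ha _ x, alt_right,
      ha _ (n x), ← hf, f_alt, im]
  have f_f_self (x : A) : f (f (f x x) x) x = f x x := by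
    have h : n (f (f x x) x) = m (n x) (f x x) := by
      rw [hf (f x x), na, nn, hf x x, hm]
    rw [hf, h, ha, ham, ha x (n x), ← hf, alt_right, im]
  refine ⟨?_, ?_, ?_, ?_⟩
  · simp only [f_alt]
  · simp only [f_alt]
  · simp only [f_alt, f_self]
  · simp only [f_alt, f_f_self, eq_comm]
end

section
/- Let A be a symmetric implication zroupoid. Then A satisfies the condition 0 → (x → x) = x → x for all x if and only if A satisfies any (equivalently, all) of the following six identities (for all x, y): (42B12): x → (x → (y → x)) = x → ((x → y) → x); (42B35): (x → x) → (y → x) = ((x → x) → y) → x; (42C23): x → ((x → y) → y) = (x → x) → (y → y); (42C25): x → ((x → y) → y) = ((x → x) → y) → y; (42C35): (x → x) → (y → y) = ((x → x) → y) → y; (42G25): x → ((y → y) → y) = ((x → y) → y) → y. Consequently, the six subvarieties of S defined by these identities all coincide. -/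
/-- A set with two commutative operations with neutral elements, each distributing over the other,
interchanged by an involution. These are the symmetric implication zroupoids, with the implication
`x → y` written as `xᶜ + y`. -/
class DeMorganBimagma (A : Type*) extends Add A, Mul A, Zero A, One A, Compl A where
  add_comm (x y : A) : x + y = y + x
  add_zero (x : A) : x + 0 = x
  mul_add (x y w : A) : x * (y + w) = x * y + x * w
  compl_compl (x : A) : xᶜᶜ = x
  compl_add (x y : A) : (x + y)ᶜ = xᶜ * yᶜ
  compl_zero : (0 : A)ᶜ = 1

namespace DeMorganBimagma

variable {A : Type*} [DeMorganBimagma A]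

theorem compl_mul (x y : A) : (x * y)ᶜ = xᶜ + yᶜ := by
  rw [← compl_compl (xᶜ + yᶜ), compl_add, compl_compl, compl_compl]

theorem compl_one : (1 : A)ᶜ = 0 := by
  rw [← compl_zero, compl_compl]

theorem mul_comm (x y : A) : x * y = y * x := by
  rw [← compl_compl (x * y), compl_mul, add_comm, compl_add, compl_compl, compl_compl]

theorem mul_one (x : A) : x * 1 = x := by
  rw [← compl_compl (x * 1), compl_mul, compl_one, add_zero, compl_compl]

theorem add_mul_distrib (x y w : A) : x + y * w = (x + y) * (x + w) := by
  have h := congrArg compl (mul_add xᶜ yᶜ wᶜ)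
  simpa only [compl_mul, compl_add, compl_compl] using h

theorem zero_add (x : A) : 0 + x = x := by rw [add_comm, add_zero]

theorem one_mul (x : A) : 1 * x = x := by rw [mul_comm, mul_one]

theorem add_mul (x y w : A) : (x + y) * w = x * w + y * w := by
  simp only [mul_comm _ w, mul_add]

theorem mul_add_zero_mul (x y : A) : x * y + 0 * y = x * y := by
  rw [← add_mul, add_zero]

theorem add_zero_mul_self (x : A) : x + 0 * x = x := by
  simpa only [one_mul] using mul_add_zero_mul 1 x

theorem mul_one_add_self (x : A) : x * (1 + x) = x := by
  have h := add_mul_distrib x 0 1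
  rwa [mul_one, add_zero, add_comm x 1, eq_comm] at h

theorem add_mul_self (x : A) : x + x * x = x := by
  simpa only [mul_add, mul_one] using mul_one_add_self x

theorem one_add_one : (1 : A) + 1 = 1 := by
  simpa only [mul_one] using add_mul_self (1 : A)

theorem add_self (x : A) : x + x = x := by
  simpa only [mul_add, mul_one] using congrArg (x * ·) (one_add_one (A := A))

theorem mul_self (x : A) : x * x = x := by
  rw [← compl_compl (x * x), compl_mul, add_self, compl_compl]

theorem mul_one_add (x y : A) : x * (1 + y) = x + x * y := by
  rw [mul_add, mul_one]

theorem mul_add_self_left (x y : A) : x * (x + y) = x + x * y := by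
  rw [mul_add, mul_self]

theorem add_mul_eq_add_zero_mul (x y : A) : x + x * y = x + 0 * y := by
  rw [← mul_add_self_left, add_mul_distrib x 0 y, add_zero]

theorem zero_mul_one_add (x : A) : 0 * (1 + x) = 0 * x := by
  rw [mul_one_add, zero_add]

theorem one_add_zero_mul (x : A) : 1 + 0 * x = 1 + x := by
  rw [add_mul_distrib, add_zero, one_mul]

theorem zero_mul_zero_mul (x : A) : 0 * (0 * x) = 0 * x := by
  rw [← zero_mul_one_add, one_add_zero_mul, zero_mul_one_add]

theorem zero_mul_mul_eq (x y : A) : 0 * x * y = 0 * x + 0 * y := by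
  have h := mul_add_zero_mul y (0 * x)
  rw [zero_mul_zero_mul, add_comm, mul_comm y, add_mul_eq_add_zero_mul] at h
  exact h.symm

theorem zero_mul_mul_zero_mul (x y : A) : (0 * x) * (0 * y) = 0 * x + 0 * y := by
  rw [zero_mul_mul_eq, zero_mul_zero_mul]

theorem zero_mul_add_add (x y w : A) :
    0 * x + (0 * y + 0 * w) = (0 * x + 0 * y) + (0 * x + 0 * w) := by
  have h := mul_add (0 * x) (0 * y) (0 * w)
  rwa [zero_mul_mul_zero_mul, zero_mul_mul_zero_mul, ← mul_add 0 y w, zero_mul_mul_zero_mul,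
    mul_add 0 y w] at h

theorem zero_mul_add_assoc (x y w : A) :
    0 * x + 0 * y + 0 * w = 0 * x + (0 * y + 0 * w) := by
  have distrib := zero_mul_add_add (A := A)
  have absorb (x y : A) : 0 * x + (0 * x + 0 * y) = 0 * x + 0 * y := by
    have h := distrib x 0 y
    rw [mul_self, zero_add, add_zero] at h
    exact h.symm
  have left_absorb (x y w : A) :
      0 * x + (0 * x + 0 * y + 0 * w) = 0 * x + 0 * y + 0 * w := by
    rw [← mul_add, distrib, mul_add, absorb, ← mul_add 0 x y, ← mul_add 0 x w]
    have h := distrib (x + y) x w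
    rw [← mul_add 0 x w, mul_add 0 x y, add_comm (0 * x + 0 * y) (0 * x), absorb] at h
    rw [mul_add 0 x y, h, ← mul_add 0 x y, absorb]
  have mid_absorb (x y w : A) :
      0 * y + (0 * x + 0 * y + 0 * w) = 0 * x + 0 * y + 0 * w := by
    rw [add_comm (0 * x), left_absorb]
  have right_absorb (x y w : A) :
      0 * w + (0 * x + 0 * y + 0 * w) = 0 * x + 0 * y + 0 * w := by
    rw [add_comm _ (0 * w), ← mul_add, absorb]
  have join_absorb (x y w : A) :
      (0 * x + (0 * y + 0 * w)) + (0 * x + 0 * y + 0 * w) = 0 * x + 0 * y + 0 * w := by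
    have h (a b c : A) (ha : 0 * a + 0 * c = 0 * c) (hb : 0 * b + 0 * c = 0 * c) :
        0 * (a + b) + 0 * c = 0 * c := by
      rw [add_comm _ (0 * c), mul_add, distrib, add_comm _ (0 * a), add_comm _ (0 * b), ha, hb,
        add_self]
    simp only [← mul_add] at *
    exact h _ _ _ (left_absorb x y w) (h _ _ _ (mid_absorb x y w) (right_absorb x y w))
  have h₁ := join_absorb x y w
  have h₂ := join_absorb w y x
  rw [add_comm (0 * y) (0 * x), add_comm (0 * w) (0 * x + 0 * y), add_comm (0 * w) (0 * y),
    add_comm _ (0 * x)] at h₂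
  rw [← h₁, add_comm, h₂]

theorem add_zero_mul_eq_mul (x y : A) : x + 0 * y = x * (1 + y) := by
  rw [mul_one_add, add_mul_eq_add_zero_mul]

theorem add_add_zero_mul_distrib (x y w : A) : x + y + 0 * w = (x + 0 * w) + (y + 0 * w) := by
  simp only [add_zero_mul_eq_mul, add_mul]

theorem add_zero_mul_add_self (x y : A) : x + 0 * (x + y) = x + 0 * y := by
  rw [mul_add, ← zero_mul_mul_zero_mul, add_mul_distrib, add_zero_mul_self, mul_add_self_left,
    add_mul_eq_add_zero_mul, zero_mul_zero_mul]

theorem add_zero_mul_add_zero_mul (x y w : A) : x + 0 * y + 0 * w = x + (0 * y + 0 * w) := by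
  have h₁ : x + (0 * y + 0 * w) = x + 0 * w + 0 * y := by
    rw [← zero_mul_mul_zero_mul, add_mul_distrib, add_mul, mul_add_self_left,
      add_mul_eq_add_zero_mul, zero_mul_zero_mul, zero_mul_mul_eq, ← mul_add,
      add_comm y, add_zero_mul_add_self]
  have h₂ : 0 * (x + 0 * w + (y + w)) = 0 * (x + 0 * w + y) := by
    simp only [mul_add, zero_mul_zero_mul, zero_mul_add_assoc]
    rw [add_comm (0 * y), ← mul_add 0 w y, zero_mul_add_assoc, mul_add, ← zero_mul_add_assoc w w,
      add_self]
  rw [h₁, add_add_zero_mul_distrib, ← mul_add, ← add_zero_mul_add_self, h₂,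
    add_zero_mul_add_self]

theorem add_add_zero_mul (x y w : A) : x + (y + 0 * w) = x + y + 0 * w := by
  have h : x + (y + 0 * w) + 0 * w = x + (y + 0 * w) := by
    rw [← add_zero_mul_self (x + (y + 0 * w)), add_zero_mul_add_zero_mul]
    simp only [mul_add, zero_mul_zero_mul]
    rw [← mul_add 0 y w, zero_mul_add_assoc, mul_add, zero_mul_add_assoc, add_self]
  rw [← h, add_add_zero_mul_distrib, add_zero_mul_add_zero_mul y, add_self,
    ← add_add_zero_mul_distrib]

theorem mul_add_self_eq (x y : A) : x * (x + y) = x + 0 * (x + y) := by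
  rw [mul_add_self_left, add_mul_eq_add_zero_mul, add_zero_mul_add_self]

theorem mul_add_add_self_eq (x y w : A) : x * (y + (x + w)) = x + 0 * (y + (x + w)) := by
  rw [mul_add, mul_add_self_left, add_mul_eq_add_zero_mul, add_add_zero_mul,
    add_comm (x * y), add_mul_eq_add_zero_mul, add_zero_mul_add_zero_mul, ← mul_add,
    ← add_zero_mul_add_self]
  congr 1
  simp only [mul_add, ← zero_mul_add_assoc]
  rw [add_comm (0 * x)]

theorem add_add_mul_add_add (x y w : A) : (x + y + w) * (x + (y + w)) = x + y + w := by
  have h : 0 * (x + (y + w)) = 0 * (x + y + w) := by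
    simp only [mul_add, zero_mul_add_assoc]
  rw [add_mul, add_mul, mul_add_self_eq, mul_add_add_self_eq, add_comm y w,
    mul_add_add_self_eq, add_comm w y, ← add_add_zero_mul_distrib, ← add_add_zero_mul_distrib, h,
    add_zero_mul_self]

theorem add_assoc (x y w : A) : x + y + w = x + (y + w) := by
  have h := add_add_mul_add_add w y x
  rw [add_comm _ x, add_comm w (y + x), add_comm w y, add_comm y x, mul_comm,
    add_add_mul_add_add] at h
  exact h

instance : Std.Associative (α := A) (· + ·) := ⟨add_assoc⟩
instance : Std.Commutative (α := A) (· + ·) := ⟨add_comm⟩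
instance : Std.IdempotentOp (α := A) (· + ·) := ⟨add_self⟩

/-- Every element `xᶜ + x`, that is `x → x`, is fixed by `1 + ·`, that is by `0 → ·`. -/
def IsBalanced (A : Type*) [DeMorganBimagma A] : Prop :=
  ∀ x : A, 1 + (xᶜ + x) = xᶜ + x

theorem one_add_mul (x y : A) : (1 + x) * y = y + 0 * x := by
  rw [add_zero_mul_eq_mul, mul_comm]

theorem add_mul_eq_mul_add (x y w : A) : x * y + w = (x + w) * (y + w) := by
  rw [add_comm, add_mul_distrib, add_comm w, add_comm w]

theorem IsBalanced.mul_eq (h : IsBalanced A) (x y w : A) :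
    (x + xᶜ + y) * w = w + 0 * (x + xᶜ + y) := by
  rw [← one_add_mul, ← add_assoc, add_comm x, h]

theorem isBalanced_iff_42B12 :
    IsBalanced A ↔ ∀ x y : A, xᶜ + (xᶜ + (yᶜ + x)) = xᶜ + ((xᶜ + y)ᶜ + x) := by
  have key (x y : A) : (xᶜ + y)ᶜ + x = x + 0 * yᶜ := by
    rw [compl_add, compl_compl, add_comm _ x, add_mul_eq_add_zero_mul]
  simp only [key]
  constructor
  · intro h x y
    have := h x
    have := one_add_zero_mul yᶜ
    grind
  · intro h x
    have := h x 0
    simp only [compl_zero, mul_one, add_zero] at this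
    grind

theorem isBalanced_iff_42B35 :
    IsBalanced A ↔ ∀ x y : A, (xᶜ + x)ᶜ + (yᶜ + x) = ((xᶜ + x)ᶜ + y)ᶜ + x := by
  have key (x y : A) : (xᶜ + x)ᶜ + (yᶜ + x) = yᶜ + x + 0 * xᶜ := by
    rw [compl_add, compl_compl, add_comm, add_assoc, add_mul_eq_add_zero_mul, add_assoc]
  have key' (x y : A) : ((xᶜ + x)ᶜ + y)ᶜ + x = (x + xᶜ) * (x + yᶜ) := by
    rw [compl_add, compl_compl, add_comm, add_mul_distrib]
    grind
  simp only [key, key']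
  constructor
  · intro h x y
    have := h.mul_eq x 0 (x + yᶜ)
    have := add_zero_mul_self x
    simp only [add_zero, mul_add] at *
    grind
  · intro h x
    have := h x 0
    have := one_add_zero_mul xᶜ
    simp only [compl_zero, add_comm x 1] at *
    have := one_add_zero_mul x
    have := one_add_mul x (x + xᶜ)
    have := mul_comm (x + xᶜ) (1 + x)
    have := add_zero_mul_self x
    grind

theorem mul_compl_add_add_compl (x y : A) :
    (xᶜ + x)ᶜ + (yᶜ + y) = (y + yᶜ + x) * (xᶜ + (yᶜ + y)) := by
  rw [compl_add, compl_compl, add_mul_eq_mul_add]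
  congr 1
  ac_rfl

theorem compl_add_mul_compl_add (x y : A) :
    xᶜ + ((xᶜ + y)ᶜ + y) = (x + xᶜ + y) * (xᶜ + (yᶜ + y)) := by
  rw [compl_add, compl_compl, add_mul_eq_mul_add, add_mul_distrib]
  congr 1
  ac_rfl

theorem add_compl_mul_compl_add (x y : A) :
    ((xᶜ + x)ᶜ + y)ᶜ + y = (x + xᶜ + y) * (yᶜ + y) := by
  rw [compl_add, compl_compl, add_mul_eq_mul_add, add_comm x]

theorem IsBalanced.mul_compl_add_add_compl_eq (h : IsBalanced A) (x y : A) :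
    (xᶜ + x)ᶜ + (yᶜ + y) = xᶜ + ((xᶜ + y)ᶜ + y) := by
  rw [mul_compl_add_add_compl, compl_add_mul_compl_add, h.mul_eq, h.mul_eq]
  have := add_zero_mul_self xᶜ
  have := add_zero_mul_self yᶜ
  have := add_zero_mul_self y
  simp only [mul_add]
  grind

theorem IsBalanced.add_compl_mul_compl_add_eq (h : IsBalanced A) (x y : A) :
    ((xᶜ + x)ᶜ + y)ᶜ + y = xᶜ + ((xᶜ + y)ᶜ + y) := by
  rw [add_compl_mul_compl_add, compl_add_mul_compl_add, h.mul_eq, h.mul_eq]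
  have := add_zero_mul_self xᶜ
  have := h y
  have := one_add_zero_mul xᶜ
  simp only [mul_add]
  grind

theorem isBalanced_iff_42C23 :
    IsBalanced A ↔ ∀ x y : A, xᶜ + ((xᶜ + y)ᶜ + y) = (xᶜ + x)ᶜ + (yᶜ + y) := by
  refine ⟨fun h x y => (h.mul_compl_add_add_compl_eq x y).symm, fun h x => ?_⟩
  have := h x 0
  simp only [add_zero, compl_compl, compl_zero] at this
  grind

theorem isBalanced_iff_42C25 :
    IsBalanced A ↔ ∀ x y : A, xᶜ + ((xᶜ + y)ᶜ + y) = ((xᶜ + x)ᶜ + y)ᶜ + y := by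
  refine ⟨fun h x y => (h.add_compl_mul_compl_add_eq x y).symm, fun h x => ?_⟩
  have := h 0 x
  simp only [add_zero, compl_zero, compl_one, zero_add] at this
  grind

theorem isBalanced_iff_42C35 :
    IsBalanced A ↔ ∀ x y : A, (xᶜ + x)ᶜ + (yᶜ + y) = ((xᶜ + x)ᶜ + y)ᶜ + y := by
  refine ⟨fun h x y => ?_, fun h x => ?_⟩
  · rw [h.mul_compl_add_add_compl_eq, h.add_compl_mul_compl_add_eq]
  · have := h x 0
    simp only [add_zero, compl_compl, compl_zero] at this
    grind

theorem isBalanced_iff_42G25 :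
    IsBalanced A ↔ ∀ x y : A, xᶜ + ((yᶜ + y)ᶜ + y) = ((xᶜ + y)ᶜ + y)ᶜ + y := by
  have key (y : A) : (yᶜ + y)ᶜ + y = y + 0 * yᶜ := by
    rw [compl_add, compl_compl, add_comm, add_mul_eq_add_zero_mul]
  have key' (x y : A) : ((xᶜ + y)ᶜ + y)ᶜ + y = (y + yᶜ) * (xᶜ + y) := by
    rw [compl_add, compl_compl, add_mul_eq_mul_add, add_assoc, add_self, mul_comm, add_comm y yᶜ]
  simp only [key, key']
  constructor
  · intro h x y
    have := h.mul_eq y 0 (xᶜ + y)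
    rw [add_zero, mul_add 0 y] at this
    have := add_zero_mul_self y
    clear key key'
    grind
  · intro h x
    have := h 0 x
    rw [compl_zero, mul_comm (x + xᶜ), one_add_mul] at this
    have := one_add_zero_mul xᶜ
    have := add_zero_mul_self x
    grind

end DeMorganBimagma

/-- In a symmetric I-zroupoid, the condition 0 → (x → x) = x → x is
equivalent to each of the six identities (42B12), (42B35), (42C23), (42C25), (42C35),
(42G25). -/
theorem stmt_13 {A : Type*} (f : A → A → A) (z : A)
    (hI : ∀ x y w : A, f (f x y) w = f (f (f (f w z) x) (f (f y w) z)) z)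
    (hI0 : f (f z z) z = z)
    (hinv : ∀ x : A, f (f x z) z = x)
    (hsym : ∀ x y : A, f (f x (f y z)) z = f (f y (f x z)) z) :
    ((∀ x : A, f z (f x x) = f x x) ↔
      (∀ x y : A, f x (f x (f y x)) = f x (f (f x y) x))) ∧
    ((∀ x : A, f z (f x x) = f x x) ↔
      (∀ x y : A, f (f x x) (f y x) = f (f (f x x) y) x)) ∧
    ((∀ x : A, f z (f x x) = f x x) ↔
      (∀ x y : A, f x (f (f x y) y) = f (f x x) (f y y))) ∧
    ((∀ x : A, f z (f x x) = f x x) ↔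
      (∀ x y : A, f x (f (f x y) y) = f (f (f x x) y) y)) ∧
    ((∀ x : A, f z (f x x) = f x x) ↔
      (∀ x y : A, f (f x x) (f y y) = f (f (f x x) y) y)) ∧
    ((∀ x : A, f z (f x x) = f x x) ↔
      (∀ x y : A, f x (f (f y y) y) = f (f (f x y) y) y)) := by
  have symm_imp (x y : A) : f (f x z) y = f (f y z) x := by
    have h := congrArg (f · z) (hsym (f x z) (f y z))
    simpa only [hinv] using h
  let inst : DeMorganBimagma A :=
    { add := fun x y => f (f x z) y
      mul := fun x y => f (f x (f y z)) z
      zero := z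
      one := f z z
      compl := fun x => f x z
      add_comm := symm_imp
      add_zero := hinv
      mul_add := fun x y w => by
        change f (f x (f (f (f y z) w) z)) z =
          f (f (f (f x (f y z)) z) z) (f (f x (f w z)) z)
        have h := hI (f y z) w (f x z)
        rw [hinv] at h
        rw [hinv, hsym, h, hinv, hsym w x]
      compl_compl := hinv
      compl_add := fun x y => by
        change f (f (f x z) y) z = f (f (f x z) (f (f y z) z)) z
        rw [hinv]
      compl_zero := rfl }
  have hf (x y : A) : f x y = xᶜ + y := by
    change f x y = f (f (f x z) z) y
    rw [hinv]
  have hz : zᶜ = 1 := rfl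
  simp only [hf, hz]
  exact ⟨DeMorganBimagma.isBalanced_iff_42B12, DeMorganBimagma.isBalanced_iff_42B35,
    DeMorganBimagma.isBalanced_iff_42C23, DeMorganBimagma.isBalanced_iff_42C25,
    DeMorganBimagma.isBalanced_iff_42C35, DeMorganBimagma.isBalanced_iff_42G25⟩
end

section
/- Let A be a symmetric implication zroupoid. Then the following conditions are equivalent: (a) A satisfies (42A12): x → (x → (x → y)) = x → ((x → x) → y) for all x, y; (b) A satisfies (42D23): x → ((y → x) → x) = (x → y) → (x → x) for all x, y; (c) A satisfies (42D35): (x → y) → (x → x) = ((x → y) → x) → x for all x, y. That is, relative to S, the varieties 42A12, 42D23, and 42D35 coincide. -/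
/-- Two commutative operations with units, each distributing over the other. -/
structure MutuallyDistributive {A : Type*} (p m : A → A → A) (o e : A) : Prop where
  add_comm : ∀ x y, p x y = p y x
  mul_comm : ∀ x y, m x y = m y x
  add_zero : ∀ x, p x o = x
  mul_one : ∀ x, m x e = x
  mul_add : ∀ x y w, m x (p y w) = p (m x y) (m x w)
  add_mul : ∀ x y w, p x (m y w) = m (p x y) (p x w)

namespace MutuallyDistributive

variable {A : Type*} {p m : A → A → A} {o e : A}

theorem dual (h : MutuallyDistributive p m o e) : MutuallyDistributive m p e o :=
  ⟨h.mul_comm, h.add_comm, h.mul_one, h.add_zero, h.add_mul, h.mul_add⟩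

theorem one_add_mul_add (h : MutuallyDistributive p m o e) (x y : A) :
    m (p e x) (p x y) = p x y := by
  have := h.add_mul x e y
  rw [h.mul_comm e y, h.mul_one] at this
  rw [h.add_comm e x, ← this]

theorem one_add_mul_self (h : MutuallyDistributive p m o e) (x : A) : m (p e x) x = x := by
  simpa only [h.add_zero] using h.one_add_mul_add x o

theorem mul_one_add (h : MutuallyDistributive p m o e) (x y : A) :
    m x (p e y) = p x (m x y) := by
  rw [h.mul_add, h.mul_one]

theorem add_self (h : MutuallyDistributive p m o e) (x : A) : p x x = x := by
  have h1 : p e e = e := by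
    have := h.one_add_mul_self e
    rwa [h.mul_one] at this
  have := h.mul_one_add x e
  rw [h1, h.mul_one] at this
  exact this.symm

theorem mul_self_add (h : MutuallyDistributive p m o e) (x y : A) :
    m x (p x y) = m x (p e y) := by
  rw [h.mul_one_add, h.mul_add, h.dual.add_self]

theorem one_add_zero_mul (h : MutuallyDistributive p m o e) (x : A) : p e (m o x) = p e x := by
  rw [h.add_mul, h.add_zero, h.mul_comm, h.mul_one]

theorem one_add_one_add (h : MutuallyDistributive p m o e) (x : A) :
    p e (p e x) = p e x := by
  rw [← h.one_add_zero_mul (p e x), h.dual.one_add_zero_mul, h.one_add_zero_mul]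

theorem one_add_add (h : MutuallyDistributive p m o e) (x y : A) :
    p (p e x) y = m (p e x) (p e y) := by
  have := h.one_add_mul_add (p e x) y
  rwa [h.one_add_one_add, h.mul_self_add, eq_comm] at this

theorem one_add_add' (h : MutuallyDistributive p m o e) (x y : A) :
    p e (p x y) = m (p e x) (p e y) := by
  rw [← h.one_add_zero_mul (p x y), h.mul_add, ← h.dual.one_add_zero_mul x,
    ← h.dual.one_add_zero_mul y, ← h.mul_add, h.one_add_zero_mul, h.one_add_add,
    h.one_add_one_add, h.add_mul, h.one_add_one_add, h.one_add_one_add]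

theorem add_assoc (h : MutuallyDistributive p m o e) (x y w : A) :
    p (p x y) w = p x (p y w) := by
  have hl : ∀ a b c, m a (p (p a b) c) = m a (m (p e b) (p e c)) := by
    intro a b c
    rw [h.mul_add, h.mul_self_add, ← h.mul_add, h.one_add_add]
  have hr : ∀ a b c, m a (p a (p b c)) = m a (m (p e b) (p e c)) := by
    intro a b c
    rw [h.mul_self_add, h.one_add_add']
  have hx : m x (p (p x y) w) = m x (p x (p y w)) := by rw [hl, hr]
  have hy : m y (p (p x y) w) = m y (p x (p y w)) := by
    rw [h.add_comm x y, hl, h.add_comm x, hl, h.mul_comm (p e x)]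
  have hw : m w (p (p x y) w) = m w (p x (p y w)) := by
    rw [h.add_comm _ w, hr, h.add_comm x, h.add_comm y w, hl, h.mul_comm (p e x)]
  generalize ha : p (p x y) w = a at *
  generalize hb : p x (p y w) = b at *
  have hba : m b a = a := by
    conv_lhs => rw [← ha]
    rw [h.mul_add, h.mul_add, h.mul_comm b, h.mul_comm b, h.mul_comm b, ← hx, ← hy, ← hw,
      h.mul_comm x, h.mul_comm y, h.mul_comm w, ← h.mul_add, ← h.mul_add, ha, h.dual.add_self]
  have hab : m a b = b := by
    conv_lhs => rw [← hb]
    rw [h.mul_add, h.mul_add, h.mul_comm a, h.mul_comm a, h.mul_comm a, hx, hy, hw,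
      h.mul_comm x, h.mul_comm y, h.mul_comm w, ← h.mul_add, ← h.mul_add, hb, h.dual.add_self]
  rw [← hba, h.mul_comm, hab]

theorem add_mul_one_add (h : MutuallyDistributive p m o e) (x y w : A) :
    p x (m y (p e w)) = m (p x y) (p e w) := by
  rw [h.add_mul, h.add_comm x (p e w), h.one_add_add, h.mul_comm (p e w), ← h.dual.add_assoc,
    h.mul_comm _ (p e x), h.one_add_mul_add]

end MutuallyDistributive


/-- In a symmetric I-zroupoid, the identities (42A12), (42D23) and (42D35)
are equivalent. -/
theorem stmt_14 {A : Type*} (f : A → A → A) (z : A)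
    (hI : ∀ x y w : A, f (f x y) w = f (f (f (f w z) x) (f (f y w) z)) z)
    (hI0 : f (f z z) z = z)
    (hinv : ∀ x : A, f (f x z) z = x)
    (hsym : ∀ x y : A, f (f x (f y z)) z = f (f y (f x z)) z) :
    ((∀ x y : A, f x (f x (f x y)) = f x (f (f x x) y)) ↔
      (∀ x y : A, f x (f (f y x) x) = f (f x y) (f x x))) ∧
    ((∀ x y : A, f x (f x (f x y)) = f x (f (f x x) y)) ↔
      (∀ x y : A, f (f x y) (f x x) = f (f (f x y) x) x)) := by
  obtain ⟨n, hn⟩ : ∃ n : A → A, ∀ x, f x z = n x := ⟨_, fun _ => rfl⟩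
  obtain ⟨p, hp⟩ : ∃ p : A → A → A, ∀ x y, f (n x) y = p x y := ⟨_, fun _ _ => rfl⟩
  obtain ⟨m, hm⟩ : ∃ m : A → A → A, ∀ x y, n (f x (n y)) = m x y := ⟨_, fun _ _ => rfl⟩
  simp only [hn] at hI hinv hsym
  have hf : ∀ x y, f x y = p (n x) y := fun x y => by rw [← hp, hinv]
  have hnp : ∀ x y, n (p x y) = m (n x) (n y) := fun x y => by rw [← hp, ← hm, hinv]
  have hnm : ∀ x y, n (m x y) = p (n x) (n y) := fun x y => by rw [← hm, hinv, hf]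
  have mc : ∀ x y, m x y = m y x := fun x y => by rw [← hm, ← hm, hsym]
  have pc : ∀ x y, p x y = p y x := fun x y => by
    rw [← hinv (p x y), hnp, mc, ← hnp, hinv]
  have pz : ∀ x, p x z = x := fun x => by rw [← hp, hn, hinv]
  have pm : ∀ x y w, p x (m y w) = m (p x y) (p x w) := fun x y w => by
    have h := hI y (n w) x
    simp only [hf, hnp, hinv, hnm] at h
    rw [pc x (m y w), h, pc x w]
  have D : MutuallyDistributive p m z (n z) := by
    refine ⟨pc, mc, pz, fun x => ?_, fun x y w => ?_, pm⟩
    · rw [← hinv (m x (n z)), hnm, hinv, pz, hinv]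
    · rw [← hinv (m x (p y w)), hnm, hnp y, pm]
      simp only [hinv, hnm, hnp]
  have key : (∀ x y : A, f x (f x (f x y)) = f x (f (f x x) y)) ↔
      ∀ y, p (n z) y = p (n z) (n y) := by
    have h1 : ∀ x y, f x (f x (f x y)) = p (n x) y := fun x y => by
      simp only [hf, ← D.add_assoc, D.add_self]
    have h2 : ∀ x y, f x (f (f x x) y) = p (m (n x) (p (n z) x)) y := fun x y => by
      simp only [hf, hnp, hinv, ← D.add_assoc]
      rw [mc x, ← D.mul_one_add]
    simp only [h1, h2]
    constructor
    · intro h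
      have h3 : ∀ y, p (n z) y = m (p (n z) y) (p (n z) (n y)) := fun y => by
        have h4 := h (n y) z
        simp only [pz, hinv] at h4
        have h5 := congrArg (p (n z)) h4
        rwa [D.add_mul, D.one_add_one_add] at h5
      intro y
      have h6 := h3 (n y)
      rw [hinv, mc] at h6
      exact (h3 y).trans h6.symm
    · intro h x y
      rw [h x, mc, D.one_add_mul_self]
  have fibre : (∀ y, p (n z) y = p (n z) (n y)) ↔
      ∀ x y, m (p x (n x)) (p (n z) y) = m (p x (n x)) (p (n z) (n y)) := by
    refine ⟨fun h x y => by rw [h y], fun h y => ?_⟩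
    have h1 := h z y
    rwa [pc z, pz, mc, mc (n z), D.mul_one, D.mul_one] at h1
  have e1 : ∀ x y, f x (f (f y x) x) = m (p x (n x)) (p (n z) y) := fun x y => by
    simp only [hf, hnp, hinv]
    rw [← D.add_assoc, mc y, ← D.mul_one_add, pc, D.add_mul_one_add]
  have e2 : ∀ x y, f (f x y) (f x x) = m (p x (n x)) (p (n z) (n y)) := fun x y => by
    simp only [hf, hnp, hinv]
    rw [pc, D.add_assoc, ← D.mul_one_add, D.add_mul_one_add, pc x]
  have e3 : ∀ x y, f (f (f x y) x) x = m (p x (n x)) (p (n z) y) := fun x y => by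
    simp only [hf, hnp, hnm, hinv]
    rw [mc, D.mul_self_add, pc, D.add_mul_one_add]
  simp only [key, fibre, e1, e2, e3]
  exact ⟨trivial, forall₂_congr fun _ _ => eq_comm⟩
end

section
/- Let A be a symmetric implication zroupoid. Then A satisfies the identity (43F25): x → ((y → z) → z) = ((x → y) → z) → z for all x, y, z if and only if A satisfies the identity (42B35): (x → x) → (y → x) = ((x → x) → y) → x for all x, y. That is, relative to S, the varieties 43F25 and 42B35 coincide. -/
/-- Two commutative idempotent operations `j` and `m` with neutral elements `o` and `e`, each of
which distributes over the other. -/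
structure MutuallyDistributive_s16 {A : Type*} (j m : A → A → A) (o e : A) : Prop where
  j_comm : ∀ x y, j x y = j y x
  m_comm : ∀ x y, m x y = m y x
  j_neutral : ∀ x, j x o = x
  m_neutral : ∀ x, m x e = x
  j_idem : ∀ x, j x x = x
  m_idem : ∀ x, m x x = x
  m_j : ∀ x y w, m x (j y w) = j (m x y) (m x w)
  j_m : ∀ x y w, j x (m y w) = m (j x y) (j x w)

namespace MutuallyDistributive_s16

variable {A : Type*} {j m : A → A → A} {o e : A}

theorem swap (h : MutuallyDistributive_s16 j m o e) : MutuallyDistributive_s16 m j e o :=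
  ⟨h.m_comm, h.j_comm, h.m_neutral, h.j_neutral, h.m_idem, h.j_idem, h.j_m, h.m_j⟩

theorem m_j_self (h : MutuallyDistributive_s16 j m o e) (x y : A) : m x (j x y) = m x (j e y) := by
  rw [h.m_j, h.m_j, h.m_idem, h.m_neutral]

theorem j_m_self (h : MutuallyDistributive_s16 j m o e) (x y : A) : j x (m x y) = m x (j e y) := by
  rw [h.m_j, h.m_neutral]

theorem m_j_one (h : MutuallyDistributive_s16 j m o e) (x y : A) : m x (j e y) = j x (m o y) := by
  rw [← h.m_j_self, h.j_m, h.j_neutral]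

theorem j_m_one_left (h : MutuallyDistributive_s16 j m o e) (x y : A) :
    m (j x y) (j e x) = j x y := by
  rw [h.j_comm e x, ← h.j_m, h.m_neutral]

theorem j_m_one_right (h : MutuallyDistributive_s16 j m o e) (x y : A) :
    m (j x y) (j e y) = j x y := by
  rw [h.j_comm x y, h.j_m_one_left]

theorem one_j_one_j (h : MutuallyDistributive_s16 j m o e) (x : A) : j e (j e x) = j e x := by
  have h1 : ∀ y, j e y = m e (j e y) := fun y => by rw [h.m_comm, h.m_neutral]
  have h2 : m o (j e x) = m o x := by rw [h.m_j_one, h.j_comm, h.j_neutral]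
  rw [h1 (j e x), h.m_j_one, h2, ← h.m_j_one, ← h1]

theorem j_m_one (h : MutuallyDistributive_s16 j m o e) (x y : A) : j x (m y (j e x)) = j x y := by
  rw [← h.m_j_self, h.j_m, h.j_comm y x, h.j_comm x (j x y), h.m_j_self, h.j_m_one_left]

theorem j_m_one_m_one (h : MutuallyDistributive_s16 j m o e) (x y : A) :
    j (m x (j e y)) (m y (j e x)) = j x y := by
  have h1 : m y (j e (m x (j e y))) = m y (j e x) := by
    rw [← h.m_j_self, h.j_m_one, h.m_j_self]
  rw [← h1, h.j_m_one, h.j_comm, h.j_m_one, h.j_comm]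

theorem m_one_j_self (h : MutuallyDistributive_s16 j m o e) (x y : A) :
    m x (j e (j x y)) = m x (j e y) := by
  rw [← h.m_j_self, h.m_j, h.m_j_self, ← h.m_j, h.m_j_self, h.one_j_one_j]

theorem j_j_self (h : MutuallyDistributive_s16 j m o e) (x y : A) : j x (j x y) = j x y := by
  rw [← h.j_m_one_m_one x (j x y), h.m_one_j_self, h.j_m_one_left, ← h.m_j_self,
    h.j_comm, h.m_comm x, h.j_m_self, h.j_m_one_left]

theorem j_m_one_assoc (h : MutuallyDistributive_s16 j m o e) (x y w : A) :
    j (m y (j e x)) w = m (j y w) (j e x) := by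
  have h1 : m (j e x) (m y (j e x)) = m y (j e x) := by rw [h.m_comm y, h.swap.j_j_self]
  rw [h.m_comm (j y w), h.m_j (j e x) y w, h.m_comm (j e x) y]
  generalize m y (j e x) = u at h1 ⊢
  have h2 : m (j u w) (j e x) = j u w := by
    rw [← h.one_j_one_j, ← h.m_j_self, h.j_comm u w, h.j_comm w u]
    nth_rw 1 [← h.j_j_self u w]
    rw [h.j_comm u (j u w), ← h.j_m, h.m_comm u, h1, h.j_comm, h.j_j_self]
  rw [← h2, h.m_comm, h.m_j, h1]

theorem j_j_m (h : MutuallyDistributive_s16 j m o e) (x y w : A) :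
    j x (j w (m x y)) = m (j x w) (j e y) := by
  have h1 : j x (m (j x w) (j w y)) = j x (m w (j w y)) := by
    rw [h.j_m, h.j_j_self, ← h.j_m]
  rw [h.j_m w, h.j_comm w x, h1, h.m_j_self, h.j_comm, h.j_m_one_assoc, h.j_comm]

theorem j_j_right (h : MutuallyDistributive_s16 j m o e) (x y w : A) :
    j (j x y) (j w y) = j (j x y) w := by
  have h1 : ∀ v, m (j (j x y) v) (j e x) = j (j x y) v := fun v => by
    rw [← h.j_m_one_assoc, h.j_m_one_left]
  have h2 : ∀ v, m (j (j x y) v) (j e y) = j (j x y) v := fun v => by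
    rw [← h.j_m_one_assoc, h.j_m_one_right]
  have h3 : m (j x y) y = m y (j e x) := by rw [h.m_comm, h.j_comm x, h.m_j, h.m_idem, h.j_m_self]
  have h4 := h.j_j_m (j x y) y w
  rw [h2, h3, h.j_comm w, h.j_m_one_assoc, h.j_comm y w] at h4
  have h5 : ∀ v, j (j x y) (m v (j e x)) = j (j x y) v := fun v => by
    rw [h.j_comm, h.j_m_one_assoc, h.j_comm v, h1]
  rw [← h4, h5]

theorem j_assoc (h : MutuallyDistributive_s16 j m o e) (x y w : A) :
    j (j x y) w = j x (j y w) := by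
  rw [← h.j_j_right, h.j_comm, h.j_j_right, h.j_comm, h.j_comm w y]

end MutuallyDistributive_s16

/-- In a symmetric I-zroupoid, identity (43F25) holds iff identity
(42B35) holds. -/
theorem stmt_16 {A : Type*} (f : A → A → A) (z : A)
    (hI : ∀ x y w : A, f (f x y) w = f (f (f (f w z) x) (f (f y w) z)) z)
    (hI0 : f (f z z) z = z)
    (hinv : ∀ x : A, f (f x z) z = x)
    (hsym : ∀ x y : A, f (f x (f y z)) z = f (f y (f x z)) z) :
    (∀ x y w : A, f x (f (f y w) w) = f (f (f x y) w) w) ↔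
      (∀ x y : A, f (f x x) (f y x) = f (f (f x x) y) x) := by
  have c : ∀ a b : A, f a (f b z) = f b (f a z) := fun a b => by
    rw [← hinv (f a (f b z)), hsym, hinv]
  -- the join, meet and involution of the derived bisemilattice
  obtain ⟨j, hj⟩ : ∃ j : A → A → A, ∀ a b, j a b = f (f a z) b := ⟨_, fun _ _ => rfl⟩
  obtain ⟨m, hm⟩ : ∃ m : A → A → A, ∀ a b, m a b = f (f a (f b z)) z := ⟨_, fun _ _ => rfl⟩
  obtain ⟨n, hn⟩ : ∃ n : A → A, ∀ a, n a = f a z := ⟨_, fun _ => rfl⟩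
  have nn : ∀ a, n (n a) = a := by simpa only [hn] using hinv
  have nj : ∀ a b, n (j a b) = m (n a) (n b) := fun a b => by rw [hj, hm, hn, hn, hn, hinv]
  have nm : ∀ a b, n (m a b) = j (n a) (n b) := fun a b => by
    rw [← nn (j _ _), nj, nn, nn]
  have hf : ∀ a b, f a b = j (n a) b := fun a b => by rw [hj, hn, hinv]
  have jc : ∀ a b, j a b = j b a := fun a b => by
    rw [hj, hj]; nth_rw 1 [← hinv b]; rw [c, hinv]
  have mc : ∀ a b, m a b = m b a := fun a b => by rw [hm, hm, hsym]
  have j0 : ∀ a, j a z = a := fun a => by rw [hj, hinv]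
  have m1 : ∀ a, m a (n z) = a := fun a => by rw [hm, hn, hinv, hinv]
  have jm : ∀ x y w, j x (m y w) = m (j x y) (j x w) := fun x y w => by
    have := hI y (n w) x
    simpa only [hf, nj, nm, nn, j0, jc _ x] using this
  have mj : ∀ x y w, m x (j y w) = j (m x y) (m x w) := fun x y w => by
    rw [← nn (m x (j y w)), nm, nj y w, jm, nm, nj, nj, nn, nn, nn]
  have h00 : m z z = z := by
    have := mj z z (n z)
    rwa [jc z, j0, m1, j0, eq_comm] at this
  have mi : ∀ a, m a a = a := fun a => by
    have := jm a z z
    rwa [h00, j0, eq_comm] at this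
  have h : MutuallyDistributive_s16 j m z (n z) :=
    ⟨jc, mc, j0, m1, fun a => by rw [← nn (j a a), nj, mi, nn], mi, mj, jm⟩
  have : Std.Associative j := ⟨h.j_assoc⟩
  have : Std.Commutative j := ⟨jc⟩
  have h1 : ∀ a b, j (m z a) (m a b) = m a b := fun a b => by
    rw [mc z, ← mj, jc, j0]
  have h2 : ∀ a b, j a (m a b) = j a (m z b) := fun a b => by
    rw [h.j_m_self, h.m_j_one]
  have h3 : ∀ x t, j x (j (m x (n x)) (m t (n x))) = j x (m t (n x)) := fun x t => by
    rw [← h.j_assoc, h2, h.j_assoc, mc t, h1]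
  have h4 : ∀ x t, j (m (j (n x) x) t) x = j x (m t (n x)) := fun x t => by
    rw [jc, mc, mj, jc (m t _), ← h.j_assoc, mc t x, h2, h.j_assoc, h1]
  simp only [hf, nj, nm, nn]
  constructor
  · intro hF x y
    have := hF y x x
    rw [mc (j (n y) x), mj, mc _ x, mc _ (n y)] at this
    rw [h4, ← h3]
    calc
      _ = j (n y) (j (m x (n x)) x) := by ac_rfl
      _ = _ := this
      _ = _ := by ac_rfl
  · intro hG x y w
    have hG' : ∀ x t, j (m x (n x)) (j t x) = j x (m t (n x)) := fun x t => by
      rw [← h4, ← nn t, hG]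
    rw [jc _ w, jc _ w, ← hG' w y, ← hG' w (j (n x) y)]
    ac_rfl
end

section
/- Let A be a symmetric implication zroupoid. Then A satisfies the identity (43A12): x → (x → (y → z)) = x → ((x → y) → z) for all x, y, z if and only if A satisfies the identity (42C12): x → (x → (y → y)) = x → ((x → y) → y) for all x, y. That is, relative to S, the varieties 43A12 and 42C12 coincide. -/
/-- Two commutative operations with units that distribute over each other. Idempotence and
associativity follow, see `BiDistrib.join_self` and `BiDistrib.join_assoc`. -/
structure BiDistrib {A : Type*} (j m : A → A → A) (o e : A) : Prop where
  jc : ∀ x y, j x y = j y x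
  mc : ∀ x y, m x y = m y x
  jm : ∀ x y w, j (m x y) w = m (j x w) (j y w)
  mj : ∀ x y w, m (j x y) w = j (m x w) (m y w)
  jo : ∀ x, j x o = x
  me : ∀ x, m x e = x

namespace BiDistrib

variable {A : Type*} {j m : A → A → A} {o e : A}

theorem dual (h : BiDistrib j m o e) : BiDistrib m j e o :=
  ⟨h.mc, h.jc, h.mj, h.jm, h.me, h.jo⟩

theorem meet_zero_zero (h : BiDistrib j m o e) : m o o = o := by
  have h3 := h.mj o e o
  grind [h.jc, h.mc, h.jo, h.me]

theorem meet_self (h : BiDistrib j m o e) (x : A) : m x x = x := by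
  have h1 := h.jm o o x
  grind [h.jc, h.jo, h.meet_zero_zero]

theorem join_self (h : BiDistrib j m o e) (x : A) : j x x = x := h.dual.meet_self x

theorem join_meet_self (h : BiDistrib j m o e) (x y : A) : j x (m x y) = m x (j e y) := by
  have h1 := h.mj e y x
  grind [h.mc, h.me]

theorem meet_join_self (h : BiDistrib j m o e) (x y : A) : m x (j x y) = j x (m o y) :=
  h.dual.join_meet_self x y

theorem meet_join_eq_join_meet (h : BiDistrib j m o e) (x y : A) :
    m x (j x y) = j x (m x y) := by
  have h1 := h.jm x y x
  grind [h.jc, h.join_self]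

theorem meet_top_eq (h : BiDistrib j m o e) (x y : A) : m x (j e y) = j x (m o y) := by
  rw [← h.join_meet_self, ← h.meet_join_eq_join_meet, h.meet_join_self]

theorem meet_zero_top (h : BiDistrib j m o e) (x : A) : m o (j e x) = m o x := by
  rw [h.meet_top_eq, h.jc, h.jo]

theorem top_meet_zero (h : BiDistrib j m o e) (x : A) : j e (m o x) = j e x :=
  h.dual.meet_zero_top x

theorem meet_zero_meet_zero (h : BiDistrib j m o e) (x : A) : m o (m o x) = m o x := by
  rw [← h.meet_zero_top (m o x), h.top_meet_zero, h.meet_zero_top]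

theorem join_absorb (h : BiDistrib j m o e) (x y : A) : j (j x y) (m o y) = j x y := by
  have h1 := h.jm x e y
  rw [← h.meet_top_eq]
  grind [h.mc, h.me]

theorem join_join_zero (h : BiDistrib j m o e) (x y w : A) :
    j (j x y) (m o w) = j (j x (m o w)) (j y (m o w)) := by
  rw [← h.meet_top_eq, h.mj, h.meet_top_eq, h.meet_top_eq]

theorem join_left_absorb (h : BiDistrib j m o e) (x y : A) : j x (j x y) = j x y := by
  have h1 : m x (j x (j x y)) = m x (j x y) := by
    have := h.mj x (j x y) x
    have h2 := h.meet_join_self x y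
    have h3 := h.meet_top_eq x y
    have h4 := h.join_meet_self x (j e y)
    have h5 := h.top_meet_zero (j e y)
    have h6 := h.meet_zero_top y
    have h7 := h.top_meet_zero y
    grind [h.jc, h.mc, h.meet_self]
  have h2 : m (j x y) (j x (j x y)) = j x y := by
    rw [h.jc x (j x y), h.meet_join_self, h.jc x y, h.join_absorb]
  have h3 := h.mj x (j x y) (j x (j x y))
  rw [h.meet_self, h1, h2] at h3
  rw [h3, h.jc, h.mc, ← h.meet_join_eq_join_meet, h.jc (j x y) x, h2]

theorem zero_join_zero (h : BiDistrib j m o e) (x y : A) :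
    j (m o x) (m o y) = m o (j x y) := by
  rw [h.mc o x, h.mc o y, ← h.mj, h.mc]

theorem join_zero_join_zero (h : BiDistrib j m o e) (x a b : A) :
    j (j x (m o a)) (m o b) = j x (m o (j a b)) := by
  have hs : ∀ x a b, j (j x (m o a)) (m o b) = j (j x (m o b)) (m o (j a b)) := by
    intro x a b
    rw [h.join_join_zero, h.zero_join_zero]
  have hab : ∀ a b, j a (j a b) = j a b := h.join_left_absorb
  have hi : ∀ x a, j (j x (m o a)) (m o a) = j x (m o a) := by
    intro x a
    have := h.join_absorb x (m o a)
    rwa [h.meet_zero_meet_zero] at this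
  have h4 := hs x b (j a b)
  rw [h.jc b (j a b), h.jc (j a b) b, h.jc a b, hab b a, hi] at *
  grind [h.jc]

theorem meet_join_join (h : BiDistrib j m o e) (x y w : A) :
    m x (j (j x y) w) = j x (m o (j y w)) := by
  have h1 : j x (j x (m o y)) = j x (m o y) := h.join_left_absorb x (m o y)
  rw [h.mc, h.mj, h.mc _ x, h.meet_join_self, h.jc, h.jm, h1, h.jc w, h.mc,
    h.meet_join_self, h.join_zero_join_zero]

theorem join_meet_of_join_eq (h : BiDistrib j m o e) {x b : A} (hb : j x b = j x e) (y : A) :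
    j x (m b y) = j x y := by
  rw [h.jc, h.jm, h.jc b, hb, h.jc x e, ← h.jm, h.mc, h.me, h.jc]

theorem join_assoc (h : BiDistrib j m o e) (x y w : A) : j (j x y) w = j x (j y w) := by
  have hx : m x (j (j x y) w) = m x (j x (j y w)) := by
    rw [h.meet_join_join, h.meet_join_self]
  have hy : m y (j (j x y) w) = m y (j x (j y w)) := by
    rw [h.jc x y, h.jc x (j y w), h.meet_join_join, h.meet_join_join, h.jc x w]
  have hw : m w (j (j x y) w) = m w (j x (j y w)) := by
    rw [h.jc _ w, h.jc y w, h.jc x (j w y), h.meet_join_join, h.meet_join_self, h.jc x y]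
  have hp : m (j (j x y) w) (j (j x y) w) = m (j (j x y) w) (j x (j y w)) := by
    rw [h.mj (j x y), h.mj x, hx, hy, hw, ← h.mj x, ← h.mj (j x y)]
  have hq : m (j x (j y w)) (j (j x y) w) = m (j x (j y w)) (j x (j y w)) := by
    rw [h.mj x, h.mj y, hx, hy, hw, ← h.mj y, ← h.mj x]
  rw [h.meet_self] at hp hq
  rw [hp, h.mc, hq]

end BiDistrib

/-- A symmetric implication zroupoid carries a mutually distributive join and meet. -/
theorem biDistrib_of_symmetric {A : Type*} (f : A → A → A) (z : A)
    (hI : ∀ x y w : A, f (f x y) w = f (f (f (f w z) x) (f (f y w) z)) z)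
    (hI0 : f (f z z) z = z)
    (hinv : ∀ x : A, f (f x z) z = x)
    (hsym : ∀ x y : A, f (f x (f y z)) z = f (f y (f x z)) z) :
    BiDistrib (fun x y => f (f x z) y) (fun x y => f (f x (f y z)) z) z (f z z) := by
  have hinj : ∀ x y, f x z = f y z → x = y := fun x y hxy => by
    rw [← hinv x, hxy, hinv]
  have jc : ∀ x y, f (f x z) y = f (f y z) x := by
    intro x y
    apply hinj
    have := hsym (f x z) (f y z)
    rwa [hinv, hinv] at this
  have jm : ∀ x y w, f (f (f (f x (f y z)) z) z) w
      = f (f (f (f x z) w) (f (f (f y z) w) z)) z := by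
    intro x y w
    rw [hinv, hI, jc w x]
  refine ⟨jc, hsym, jm, ?_, hinv, ?_⟩
  · intro x y w
    have := jm (f x z) (f y z) (f w z)
    apply hinj
    simp only [hinv] at *
    exact this
  · intro x
    simp only [hI0, hinv]

/-- In a symmetric I-zroupoid, identity (43A12) holds iff identity
(42C12) holds. -/
theorem stmt_17 {A : Type*} (f : A → A → A) (z : A)
    (hI : ∀ x y w : A, f (f x y) w = f (f (f (f w z) x) (f (f y w) z)) z)
    (hI0 : f (f z z) z = z)
    (hinv : ∀ x : A, f (f x z) z = x)
    (hsym : ∀ x y : A, f (f x (f y z)) z = f (f y (f x z)) z) :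
    (∀ x y w : A, f x (f x (f y w)) = f x (f (f x y) w)) ↔
      (∀ x y : A, f x (f x (f y y)) = f x (f (f x y) y)) := by
  refine ⟨fun h x y => h x y y, fun h x y w => ?_⟩
  have hd := biDistrib_of_symmetric f z hI hI0 hinv hsym
  have absorb : ∀ x y, f x (f x y) = f x y := fun x y => by
    have := hd.join_left_absorb (f x z) y
    rwa [hinv] at this
  have assoc : ∀ x y w, f x (f y w) = f (f (f x (f y z)) z) w := fun x y w => by
    have := hd.join_assoc (f x z) (f y z) w
    simp only [hinv] at this
    exact this.symm
  have self_eq : ∀ x, f x x = f x (f z z) := fun x => by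
    have := h x z
    rw [absorb, hinv] at this
    exact this.symm
  have key : ∀ x y, f x (f (f x y) z) = f x (f y z) := by
    intro x y
    have := hd.join_meet_of_join_eq (x := f x z) (b := x) (by simpa only [hinv] using self_eq x) (f y z)
    simpa only [hinv] using this
  rw [absorb, assoc x (f x y) w, assoc x y w, key]
end
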